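/- Let n ≥ 2 be an integer, p₀, p ∈ Sⁿ and a ∈ (0,π), and suppose p ∉ B(p₀,a), i.e. arccos⟨p₀,p⟩ ≥ a. Then (1/|B_a|) · ∫_{q ∈ B(p₀,a)} g_n(‖p − q‖) dσ(q) = g_n(‖p − p₀‖) + K(n,a), where |B_a| = V_{n−1}·∫₀^a sin^{n−1}r dr. -/

import Mathlib

open MeasureTheory Real Filter
open scoped RealInnerProductSpace

noncomputable def poch (x : ℝ) (k : ℕ) : ℝ := ∏ i ∈ Finset.range k, (x + i)

noncomputable def incBeta (x α β : ℝ) : ℝ := ∫ t in (0:ℝ)..x, t ^ (α - 1) * (1 - t) ^ (β - 1)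

noncomputable def sphereVol (n : ℕ) : ℝ :=
  2 * Real.pi ^ (((n : ℝ) + 1) / 2) / Real.Gamma (((n : ℝ) + 1) / 2)

noncomputable def green (n : ℕ) (t : ℝ) : ℝ :=
  2 / (n * sphereVol n) * ∑' k : ℕ,
    poch n k / (((k : ℝ) + 1) * poch ((n : ℝ) / 2 + 1) k) *
      ((1 - t ^ 2 / 4) ^ (k + 1)
        - incBeta 1 ((n : ℝ) / 2) ((n : ℝ) / 2 + k + 1) / incBeta 1 ((n : ℝ) / 2) ((n : ℝ) / 2))

noncomputable def Kfun (n : ℕ) (a : ℝ) : ℝ :=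
  2 / (n * sphereVol n) * ∑' k : ℕ,
    poch n k / (poch ((n : ℝ) / 2 + 1) k * ((k : ℝ) + 1)) *
      (incBeta (Real.sin (a / 2) ^ 2) ((n : ℝ) / 2 + k + 1) ((n : ℝ) / 2) /
        incBeta (Real.sin (a / 2) ^ 2) ((n : ℝ) / 2) ((n : ℝ) / 2))

noncomputable def ballVol (n : ℕ) (a : ℝ) : ℝ :=
  sphereVol (n - 1) * ∫ r in (0:ℝ)..a, Real.sin r ^ (n - 1)

noncomputable def sphereMeasure (n : ℕ) :
    Measure (Metric.sphere (0 : EuclideanSpace ℝ (Fin (n + 1))) 1) :=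
  (volume : Measure (EuclideanSpace ℝ (Fin (n + 1)))).toSphere

open scoped ENNReal

section PolarCoordinates

variable {E : Type*} [NormedAddCommGroup E] [NormedSpace ℝ E] [MeasurableSpace E] [BorelSpace E]
  [FiniteDimensional ℝ E] [Nontrivial E]

lemma lintegral_eq_lintegral_toSphere (μ : Measure E) [μ.IsAddHaarMeasure] {F : E → ℝ≥0∞}
    (hF : Measurable F) :
    ∫⁻ x, F x ∂μ = ∫⁻ ω, (∫⁻ r in Set.Ioi (0 : ℝ),
      ENNReal.ofReal (r ^ (Module.finrank ℝ E - 1)) * F (r • (ω : E))) ∂μ.toSphere := by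
  have hpres := μ.measurePreserving_homeomorphUnitSphereProd
  calc ∫⁻ x, F x ∂μ = ∫⁻ x : ({0}ᶜ : Set E), F x ∂(μ.comap (↑)) := by
        rw [lintegral_subtype_comap (measurableSet_singleton _).compl,
          restrict_compl_singleton]
    _ = ∫⁻ z, F (z.2.1 • (z.1 : E))
          ∂(μ.toSphere.prod (Measure.volumeIoiPow (Module.finrank ℝ E - 1))) := by
        rw [← hpres.lintegral_comp_emb (Homeomorph.measurableEmbedding _)]
        refine lintegral_congr fun x ↦ ?_
        have hx : ‖(x : E)‖ ≠ 0 := norm_ne_zero_iff.2 x.2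
        simp [smul_smul, hx]
    _ = _ := by
        rw [lintegral_prod _ (by fun_prop)]
        refine lintegral_congr fun ω ↦ ?_
        rw [Measure.volumeIoiPow, lintegral_withDensity_eq_lintegral_mul _ (by fun_prop)
          (by fun_prop)]
        exact lintegral_subtype_comap measurableSet_Ioi
          (fun r : ℝ ↦ ENNReal.ofReal (r ^ (Module.finrank ℝ E - 1)) * F (r • (ω : E)))

lemma lintegral_fun_norm (μ : Measure E) [μ.IsAddHaarMeasure] {f : ℝ → ℝ≥0∞} (hf : Measurable f) :
    ∫⁻ x, f ‖x‖ ∂μ = μ.toSphere Set.univ *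
      ∫⁻ r in Set.Ioi (0 : ℝ), ENNReal.ofReal (r ^ (Module.finrank ℝ E - 1)) * f r := by
  rw [lintegral_eq_lintegral_toSphere μ (F := fun x ↦ f ‖x‖) (by fun_prop), mul_comm,
    ← lintegral_const]
  refine lintegral_congr fun ω ↦ setLIntegral_congr_fun measurableSet_Ioi fun r hr ↦ ?_
  have : ‖(ω : E)‖ = 1 := by simp
  simp [norm_smul, this, abs_of_pos (Set.mem_Ioi.1 hr)]

end PolarCoordinates

lemma exists_orthonormalBasis_apply_zero {n : ℕ} {v : EuclideanSpace ℝ (Fin (n + 1))}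
    (hv : ‖v‖ = 1) :
    ∃ b : OrthonormalBasis (Fin (n + 1)) ℝ (EuclideanSpace ℝ (Fin (n + 1))), b 0 = v := by
  obtain ⟨b, hb⟩ := Orthonormal.exists_orthonormalBasis_extension_of_card_eq (𝕜 := ℝ)
    (E := EuclideanSpace ℝ (Fin (n + 1))) (ι := Fin (n + 1)) (by simp) (v := fun _ ↦ v) (s := {0})
    (by
      refine ⟨fun _ ↦ hv, fun i j hij ↦ (hij ?_).elim⟩
      exact Subsingleton.elim _ _)
  exact ⟨b, hb 0 rfl⟩

lemma exists_measurePreserving_prod {n : ℕ} {v : EuclideanSpace ℝ (Fin (n + 1))} (hv : ‖v‖ = 1) :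
    ∃ ψ : ℝ × EuclideanSpace ℝ (Fin n) ≃ᵐ EuclideanSpace ℝ (Fin (n + 1)),
      MeasurePreserving ψ ∧ (∀ z, ⟪v, ψ z⟫ = z.1) ∧ ∀ z, ‖ψ z‖ = √(z.1 ^ 2 + ‖z.2‖ ^ 2) := by
  obtain ⟨b, hb⟩ := exists_orthonormalBasis_apply_zero hv
  let e := MeasurableEquiv.piFinSuccAbove (fun _ : Fin (n + 1) ↦ ℝ) 0
  have he := (volume_preserving_piFinSuccAbove (fun _ : Fin (n + 1) ↦ ℝ) 0).symm e
  let ψ : ℝ × EuclideanSpace ℝ (Fin n) ≃ᵐ EuclideanSpace ℝ (Fin (n + 1)) :=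
    (((MeasurableEquiv.refl ℝ).prodCongr (MeasurableEquiv.toLp 2 (Fin n → ℝ)).symm).trans
      e.symm).trans ((MeasurableEquiv.toLp 2 (Fin (n + 1) → ℝ)).trans
        b.repr.symm.toMeasurableEquiv)
  have hψ : ∀ z, ψ z = b.repr.symm (WithLp.toLp 2 (Fin.cons z.1 z.2.ofLp)) := fun z ↦ by
    simp [ψ, e, MeasurableEquiv.prodCongr, Fin.consEquiv]
  refine ⟨ψ, ?_, fun z ↦ ?_, fun z ↦ ?_⟩
  · refine (((MeasurePreserving.id _).prod (PiLp.volume_preserving_ofLp (Fin n))).trans he).trans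
      ((PiLp.volume_preserving_toLp _).trans (LinearIsometryEquiv.measurePreserving _))
  · rw [hψ, ← hb, ← b.repr_apply_apply]
    simp
  · rw [hψ, LinearIsometryEquiv.norm_map, EuclideanSpace.norm_eq, Fin.sum_univ_succ,
      EuclideanSpace.norm_eq, Real.sq_sqrt (by positivity)]
    simp

lemma lintegral_Ioi_pow_mul_indicator_ne (k : ℕ) :
    ∫⁻ r in Set.Ioi (0 : ℝ), ENNReal.ofReal (r ^ k) * (Set.Iio (1 : ℝ)).indicator 1 r ≠ 0 ∧
      ∫⁻ r in Set.Ioi (0 : ℝ), ENNReal.ofReal (r ^ k) * (Set.Iio (1 : ℝ)).indicator 1 r ≠ ∞ := by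
  have hc : ∫⁻ r in Set.Ioi (0 : ℝ), ENNReal.ofReal (r ^ k) * (Set.Iio (1 : ℝ)).indicator 1 r =
      ∫⁻ r in Set.Ioo (0 : ℝ) 1, ENNReal.ofReal (r ^ k) := by
    rw [← Set.Ioi_inter_Iio, Set.inter_comm, ← Measure.restrict_restrict measurableSet_Iio,
      ← lintegral_indicator measurableSet_Iio]
    refine lintegral_congr fun r ↦ ?_
    by_cases hr : r < 1 <;> simp [hr]
  rw [hc]
  constructor
  · refine ((setLIntegral_pos_iff (by fun_prop)).2 ?_).ne'
    have : Function.support (fun r : ℝ ↦ ENNReal.ofReal (r ^ k)) ∩ Set.Ioo 0 1 = Set.Ioo 0 1 :=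
      Set.inter_eq_right.2 fun r hr ↦ by simpa using pow_pos hr.1 k
    simp [this]
  · refine ne_top_of_le_ne_top (b := volume (Set.Ioo (0 : ℝ) 1)) (by simp) ?_
    rw [← setLIntegral_one]
    refine setLIntegral_mono measurable_const fun r hr ↦ ?_
    exact ENNReal.ofReal_le_one.2 (pow_le_one₀ hr.1.le hr.2.le)

lemma lintegral_lintegral_Ioi_pow_mul (m : ℕ) {χ g : ℝ → ℝ≥0∞} (hχ : Measurable χ)
    (hg : Measurable g) :
    ∫⁻ x : ℝ, ∫⁻ s in Set.Ioi (0 : ℝ), ENNReal.ofReal (s ^ m) *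
        (χ (√(x ^ 2 + s ^ 2)) * g (x / √(x ^ 2 + s ^ 2))) =
      (∫⁻ r in Set.Ioi (0 : ℝ), ENNReal.ofReal (r ^ (m + 1)) * χ r) *
        ∫⁻ φ in Set.Ioo 0 π, ENNReal.ofReal (sin φ ^ m) * g (cos φ) := by
  let H : ℝ × ℝ → ℝ≥0∞ := fun z ↦ χ (√(z.1 ^ 2 + z.2 ^ 2)) * g (z.1 / √(z.1 ^ 2 + z.2 ^ 2))
  have hH : Measurable H := by fun_prop
  let H' : ℝ × ℝ → ℝ≥0∞ := fun z ↦
    (Set.Ioi (0 : ℝ)).indicator 1 z.2 * (ENNReal.ofReal (z.2 ^ m) * H z)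
  have hH' : Measurable H' := by
    have : Measurable ((Set.Ioi (0 : ℝ)).indicator (1 : ℝ → ℝ≥0∞)) :=
      measurable_one.indicator measurableSet_Ioi
    fun_prop
  calc ∫⁻ x : ℝ, ∫⁻ s in Set.Ioi (0 : ℝ), ENNReal.ofReal (s ^ m) *
        (χ (√(x ^ 2 + s ^ 2)) * g (x / √(x ^ 2 + s ^ 2)))
      = ∫⁻ x : ℝ, ∫⁻ s : ℝ, H' (x, s) := by
        refine lintegral_congr fun x ↦ ?_
        rw [← lintegral_indicator measurableSet_Ioi]
        refine lintegral_congr fun s ↦ ?_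
        by_cases hs : 0 < s <;> simp [H', H, hs]
    _ = ∫⁻ z, H' z := by
        rw [Measure.volume_eq_prod, lintegral_prod _ hH'.aemeasurable]
    _ = ∫⁻ z in Set.Ioi (0 : ℝ) ×ˢ Set.Ioo (-π) π,
          (ENNReal.ofReal (z.1 ^ (m + 1)) * χ z.1) *
            (Set.Ioo 0 π).indicator (fun φ ↦ ENNReal.ofReal (sin φ ^ m) * g (cos φ)) z.2 := by
        rw [← lintegral_comp_polarCoord_symm]
        refine setLIntegral_congr_fun (measurableSet_Ioi.prod measurableSet_Ioo) ?_
        rintro ⟨r, φ⟩ ⟨hr : 0 < r, hφ : -π < φ ∧ φ < π⟩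
        have hsq : √((r * cos φ) ^ 2 + (r * sin φ) ^ 2) = r := by
          rw [show (r * cos φ) ^ 2 + (r * sin φ) ^ 2 = r ^ 2 by
            linear_combination r ^ 2 * Real.sin_sq_add_cos_sq φ, Real.sqrt_sq hr.le]
        by_cases h0 : 0 < φ
        · have hs : 0 < sin φ := sin_pos_of_pos_of_lt_pi h0 hφ.2
          have hmem : φ ∈ Set.Ioo 0 π := ⟨h0, hφ.2⟩
          have hrs : 0 < r * sin φ := mul_pos hr hs
          have hpow : ENNReal.ofReal ((r * sin φ) ^ m) =
              ENNReal.ofReal (r ^ m) * ENNReal.ofReal (sin φ ^ m) := by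
            rw [mul_pow, ENNReal.ofReal_mul (pow_nonneg hr.le _)]
          have hpow' : ENNReal.ofReal (r ^ (m + 1)) =
              ENNReal.ofReal (r ^ m) * ENNReal.ofReal r := by
            rw [pow_succ, ENNReal.ofReal_mul (pow_nonneg hr.le _)]
          simp only [polarCoord_symm_apply, H', H, hsq, Set.indicator, hmem, Set.mem_Ioi, hrs,
            if_true, Pi.one_apply, one_mul, smul_eq_mul, hpow, hpow',
            mul_div_cancel_left₀ _ hr.ne']
          ring
        · have hs : sin φ ≤ 0 := sin_nonpos_of_nonpos_of_neg_pi_le (not_lt.1 h0) hφ.1.le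
          have hrs : ¬ 0 < r * sin φ := not_lt.2 (mul_nonpos_of_nonneg_of_nonpos hr.le hs)
          simp [H', h0, hrs]
    _ = _ := by
        rw [Measure.volume_eq_prod, ← Measure.prod_restrict,
          lintegral_prod_mul (f := fun r ↦ ENNReal.ofReal (r ^ (m + 1)) * χ r)]
        · rw [setLIntegral_indicator measurableSet_Ioo, Set.inter_eq_left.2]
          exact Set.Ioo_subset_Ioo_left (by linarith [pi_pos])
        · fun_prop
        · refine (Measurable.indicator ?_ measurableSet_Ioo).aemeasurable
          fun_prop

lemma lintegral_sphereMeasure_inner {n : ℕ} (hn : 1 ≤ n)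
    (p₀ : Metric.sphere (0 : EuclideanSpace ℝ (Fin (n + 1))) 1) {g : ℝ → ℝ≥0∞}
    (hg : Measurable g) :
    ∫⁻ q, g ⟪(p₀ : EuclideanSpace ℝ (Fin (n + 1))), (q : EuclideanSpace ℝ (Fin (n + 1)))⟫
        ∂(sphereMeasure n) =
      (volume : Measure (EuclideanSpace ℝ (Fin n))).toSphere Set.univ *
        ∫⁻ φ in Set.Ioo 0 π, ENNReal.ofReal (sin φ ^ (n - 1)) * g (cos φ) := by
  obtain ⟨m, rfl⟩ : ∃ m, n = m + 1 := ⟨n - 1, by omega⟩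
  let χ : ℝ → ℝ≥0∞ := (Set.Iio (1 : ℝ)).indicator 1
  have hχ : Measurable χ := measurable_one.indicator measurableSet_Iio
  obtain ⟨hc0, hct⟩ := lintegral_Ioi_pow_mul_indicator_ne (m + 1)
  let F : EuclideanSpace ℝ (Fin (m + 1 + 1)) → ℝ≥0∞ := fun x ↦
    χ ‖x‖ * g (⟪(p₀ : EuclideanSpace ℝ (Fin (m + 1 + 1))), x⟫ / ‖x‖)
  have hF : Measurable F := by fun_prop
  have h1 : ∫⁻ x, F x = (∫⁻ r in Set.Ioi (0 : ℝ), ENNReal.ofReal (r ^ (m + 1)) * χ r) *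
      ∫⁻ q, g ⟪(p₀ : EuclideanSpace ℝ (Fin (m + 1 + 1))),
        (q : EuclideanSpace ℝ (Fin (m + 1 + 1)))⟫ ∂(sphereMeasure (m + 1)) := by
    rw [lintegral_eq_lintegral_toSphere _ hF, ← lintegral_const_mul _ (by fun_prop)]
    refine lintegral_congr fun ω ↦ ?_
    rw [← lintegral_mul_const _ (by fun_prop)]
    refine setLIntegral_congr_fun measurableSet_Ioi fun r (hr : 0 < r) ↦ ?_
    have hω : ‖(ω : EuclideanSpace ℝ (Fin (m + 1 + 1)))‖ = 1 := by simp
    simp [F, norm_smul, hω, abs_of_pos hr, inner_smul_right, hr.ne', mul_assoc]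
  obtain ⟨ψ, hψ, hψ1, hψ2⟩ := exists_measurePreserving_prod
    (v := (p₀ : EuclideanSpace ℝ (Fin (m + 1 + 1)))) (by simp)
  have h2 : ∫⁻ x, F x = ∫⁻ x : ℝ, ∫⁻ y : EuclideanSpace ℝ (Fin (m + 1)),
      χ (√(x ^ 2 + ‖y‖ ^ 2)) * g (x / √(x ^ 2 + ‖y‖ ^ 2)) := by
    rw [← hψ.lintegral_comp_emb ψ.measurableEmbedding, Measure.volume_eq_prod,
      lintegral_prod _ (by fun_prop)]
    simp only [F, hψ1, hψ2]
  have h3 (x : ℝ) := lintegral_fun_norm (volume : Measure (EuclideanSpace ℝ (Fin (m + 1))))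
    (f := fun s ↦ χ (√(x ^ 2 + s ^ 2)) * g (x / √(x ^ 2 + s ^ 2))) (by fun_prop)
  simp only [finrank_euclideanSpace_fin, Nat.add_sub_cancel] at h3
  simp only [h3] at h2
  rw [lintegral_const_mul'' _ ?_, lintegral_lintegral_Ioi_pow_mul m hχ hg] at h2
  · rw [h2, ← mul_assoc, mul_comm (Measure.toSphere _ _), mul_assoc] at h1
    exact ((ENNReal.mul_right_inj hc0 hct).1 h1).symm
  · refine Measurable.aemeasurable (Measurable.lintegral_prod_right' (f := fun z : ℝ × ℝ ↦
      ENNReal.ofReal (z.2 ^ m) * (χ (√(z.1 ^ 2 + z.2 ^ 2)) * g (z.1 / √(z.1 ^ 2 + z.2 ^ 2)))) ?_)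
    fun_prop

lemma toSphere_univ_toReal {n : ℕ} (hn : 1 ≤ n) :
    ((volume : Measure (EuclideanSpace ℝ (Fin n))).toSphere Set.univ).toReal =
      sphereVol (n - 1) := by
  have : Nonempty (Fin n) := ⟨⟨0, hn⟩⟩
  have hn0 : (0 : ℝ) < n := by exact_mod_cast hn
  have hG : 0 < Real.Gamma ((n : ℝ) / 2) := Real.Gamma_pos_of_pos (by positivity)
  rw [Measure.toSphere_apply_univ, EuclideanSpace.volume_ball, sphereVol, Nat.cast_sub hn,
    Real.Gamma_add_one (by positivity)]
  simp only [finrank_euclideanSpace_fin, Fintype.card_fin, ENNReal.ofReal_one, one_pow, one_mul,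
    ENNReal.toReal_mul, ENNReal.toReal_natCast, Nat.cast_one, sub_add_cancel]
  rw [ENNReal.toReal_ofReal (by positivity), Real.sqrt_eq_rpow, ← Real.rpow_natCast,
    ← Real.rpow_mul pi_pos.le, show (1 : ℝ) / 2 * n = n / 2 by ring]
  field_simp

lemma map_inner_sphereMeasure {n : ℕ} (hn : 1 ≤ n)
    (p₀ : Metric.sphere (0 : EuclideanSpace ℝ (Fin (n + 1))) 1) :
    (sphereMeasure n).map (fun q : Metric.sphere (0 : EuclideanSpace ℝ (Fin (n + 1))) 1 ↦
        ⟪(p₀ : EuclideanSpace ℝ (Fin (n + 1))), (q : EuclideanSpace ℝ (Fin (n + 1)))⟫) =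
      (volume : Measure (EuclideanSpace ℝ (Fin n))).toSphere Set.univ •
        ((volume.restrict (Set.Ioo 0 π)).withDensity
          fun φ ↦ ENNReal.ofReal (sin φ ^ (n - 1))).map cos := by
  ext s hs
  have h := lintegral_sphereMeasure_inner hn p₀ (g := s.indicator 1)
    (measurable_one.indicator hs)
  rw [← lintegral_map (f := s.indicator 1) (measurable_one.indicator hs) (by fun_prop),
    lintegral_indicator_one hs] at h
  rw [h, Measure.smul_apply, Measure.map_apply (by fun_prop) hs,
    withDensity_apply _ (measurable_cos hs), smul_eq_mul,
    ← lintegral_indicator (measurable_cos hs)]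
  congr 1
  refine lintegral_congr fun φ ↦ ?_
  by_cases hφ : cos φ ∈ s <;> simp [hφ]

lemma setIntegral_cap_inner {n : ℕ} (hn : 1 ≤ n)
    (p₀ : Metric.sphere (0 : EuclideanSpace ℝ (Fin (n + 1))) 1) {a : ℝ} (ha : a ∈ Set.Ioo 0 π)
    {f : ℝ → ℝ} (hf : Measurable f) :
    ∫ q in {q : Metric.sphere (0 : EuclideanSpace ℝ (Fin (n + 1))) 1 |
        arccos ⟪(p₀ : EuclideanSpace ℝ (Fin (n + 1))), (q : EuclideanSpace ℝ (Fin (n + 1)))⟫ < a},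
      f ⟪(p₀ : EuclideanSpace ℝ (Fin (n + 1))), (q : EuclideanSpace ℝ (Fin (n + 1)))⟫
        ∂(sphereMeasure n) =
      sphereVol (n - 1) * ∫ r in (0 : ℝ)..a, sin r ^ (n - 1) * f (cos r) := by
  have hT : MeasurableSet {u : ℝ | arccos u < a} :=
    measurableSet_lt measurable_arccos measurable_const
  have h := setIntegral_map (μ := sphereMeasure n) (f := f)
    (g := fun q : Metric.sphere (0 : EuclideanSpace ℝ (Fin (n + 1))) 1 ↦
    ⟪(p₀ : EuclideanSpace ℝ (Fin (n + 1))), (q : EuclideanSpace ℝ (Fin (n + 1)))⟫) hT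
    hf.aestronglyMeasurable (by fun_prop)
  refine h.symm.trans ?_
  rw [map_inner_sphereMeasure hn, Measure.restrict_smul, integral_smul_measure,
    toSphere_univ_toReal hn, smul_eq_mul,
    setIntegral_map hT hf.aestronglyMeasurable (by fun_prop),
    restrict_withDensity (measurable_cos hT), Measure.restrict_restrict (measurable_cos hT)]
  have hset : cos ⁻¹' {u : ℝ | arccos u < a} ∩ Set.Ioo 0 π = Set.Ioo 0 a := by
    ext x
    constructor
    · rintro ⟨h1, h2⟩
      have : arccos (cos x) < a := h1
      rw [arccos_cos h2.1.le h2.2.le] at this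
      exact ⟨h2.1, this⟩
    · rintro ⟨h1, h2⟩
      refine ⟨?_, h1, h2.trans ha.2⟩
      change arccos (cos x) < a
      rwa [arccos_cos h1.le (h2.trans ha.2).le]
  rw [hset, integral_withDensity_eq_integral_toReal_smul (by fun_prop) (by simp),
    intervalIntegral.integral_of_le ha.1.le, integral_Ioc_eq_integral_Ioo]
  congr 1
  refine setIntegral_congr_fun measurableSet_Ioo fun r hr ↦ ?_
  have : 0 ≤ sin r := sin_nonneg_of_nonneg_of_le_pi hr.1.le (hr.2.trans ha.2).le
  simp [ENNReal.toReal_ofReal (pow_nonneg this _)]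

section ParametricIntegral

variable {X : Type*} [TopologicalSpace X] [MeasurableSpace X] [OpensMeasurableSpace X]
  {μ : Measure X} [IsFiniteMeasure μ] {K : Set X}

lemma integrable_of_continuousOn_of_ae_mem (hK : IsCompact K) (hKm : MeasurableSet K)
    (hμ : ∀ᵐ x ∂μ, x ∈ K) {f : X → ℝ} (hf : ContinuousOn f K) : Integrable f μ := by
  obtain ⟨M, hM⟩ := hK.exists_bound_of_continuousOn hf
  refine Integrable.of_bound (C := M) ?_ (hμ.mono fun x hx ↦ hM x hx)
  rw [← Measure.restrict_eq_self_of_ae_mem hμ]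
  exact hf.aestronglyMeasurable hKm

lemma hasDerivAt_integral_of_continuousOn (hK : IsCompact K) (hKm : MeasurableSet K)
    (hμ : ∀ᵐ x ∂μ, x ∈ K) {f f' : ℝ → X → ℝ} {T : Set ℝ} (hT : IsOpen T) {t₀ : ℝ} (ht₀ : t₀ ∈ T)
    (hf : ∀ t ∈ T, ContinuousOn (f t) K)
    (hf' : ContinuousOn (fun z : ℝ × X ↦ f' z.1 z.2) (T ×ˢ K))
    (hd : ∀ t ∈ T, ∀ x ∈ K, HasDerivAt (fun s ↦ f s x) (f' t x) t) :
    HasDerivAt (fun t ↦ ∫ x, f t x ∂μ) (∫ x, f' t₀ x ∂μ) t₀ := by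
  obtain ⟨ε, hε, hεT⟩ := Metric.nhds_basis_closedBall.mem_iff.1 (hT.mem_nhds ht₀)
  obtain ⟨M, hM⟩ := ((isCompact_closedBall t₀ ε).prod hK).exists_bound_of_continuousOn
    (hf'.mono (Set.prod_mono_left hεT))
  have hf'₀ : ContinuousOn (f' t₀) K :=
    hf'.comp (f := fun x ↦ (t₀, x)) (by fun_prop) fun x hx ↦ ⟨ht₀, hx⟩
  refine (hasDerivAt_integral_of_dominated_loc_of_deriv_le (bound := fun _ ↦ M)
    (Metric.closedBall_mem_nhds t₀ hε) ?_
    (integrable_of_continuousOn_of_ae_mem hK hKm hμ (hf t₀ ht₀))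
    (integrable_of_continuousOn_of_ae_mem hK hKm hμ hf'₀).1 ?_ (integrable_const M) ?_).2
  · filter_upwards [hT.mem_nhds ht₀] with t ht
    exact (integrable_of_continuousOn_of_ae_mem hK hKm hμ (hf t ht)).1
  · exact hμ.mono fun x hx t ht ↦ hM (t, x) ⟨ht, hx⟩
  · exact hμ.mono fun x hx t ht ↦ hd t (hεT ht) x hx

end ParametricIntegral

section ZonalDerivatives

variable {E : Type*} [NormedAddCommGroup E] [InnerProductSpace ℝ E] [MeasurableSpace E]
  [BorelSpace E]
  {μ : Measure (Metric.sphere (0 : E) 1)} [IsFiniteMeasure μ] {K : Set (Metric.sphere (0 : E) 1)}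
  {I : Set ℝ} {G G' G'' : ℝ → ℝ} {γ γ' γ'' : ℝ → E} {T : Set ℝ}

lemma hasDerivAt_integral_comp_inner (hK : IsCompact K) (hμ : ∀ᵐ q ∂μ, q ∈ K)
    (hG : ∀ u ∈ I, HasDerivAt G (G' u) u) (hG' : ContinuousOn G' I)
    (hγ : ∀ t, HasDerivAt γ (γ' t) t) (hγ' : Continuous γ') (hT : IsOpen T)
    (hTK : ∀ t ∈ T, ∀ q ∈ K, ⟪γ t, (q : E)⟫ ∈ I) {t : ℝ} (ht : t ∈ T) :
    HasDerivAt (fun t ↦ ∫ q, G ⟪γ t, (q : E)⟫ ∂μ)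
      (∫ q, G' ⟪γ t, (q : E)⟫ * ⟪γ' t, (q : E)⟫ ∂μ) t := by
  have hc : Continuous γ := continuous_iff_continuousAt.2 fun t ↦ (hγ t).continuousAt
  have hGc : ContinuousOn G I := fun u hu ↦ (hG u hu).continuousAt.continuousWithinAt
  refine hasDerivAt_integral_of_continuousOn hK hK.isClosed.measurableSet hμ
    (f := fun t q ↦ G ⟪γ t, (q : E)⟫)
    (f' := fun t q ↦ G' ⟪γ t, (q : E)⟫ * ⟪γ' t, (q : E)⟫) hT ht ?_ ?_ ?_
  · intro s hs
    exact hGc.comp (f := fun q : Metric.sphere (0 : E) 1 ↦ ⟪γ s, (q : E)⟫) (by fun_prop) (hTK s hs)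
  · refine ContinuousOn.mul (hG'.comp (f := fun z : ℝ × Metric.sphere (0 : E) 1 ↦
      ⟪γ z.1, (z.2 : E)⟫) (by fun_prop) fun z hz ↦ hTK z.1 hz.1 z.2 hz.2) (by fun_prop)
  · intro s hs q hq
    have := (hγ s).inner ℝ (hasDerivAt_const s (q : E))
    simp only [inner_zero_right, zero_add] at this
    exact (hG _ (hTK s hs q hq)).comp s this

lemma hasDerivAt_integral_comp_inner_mul (hK : IsCompact K) (hμ : ∀ᵐ q ∂μ, q ∈ K)
    (hG' : ∀ u ∈ I, HasDerivAt G' (G'' u) u) (hG'' : ContinuousOn G'' I)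
    (hγ : ∀ t, HasDerivAt γ (γ' t) t) (hγ' : ∀ t, HasDerivAt γ' (γ'' t) t) (hγ'' : Continuous γ'')
    (hT : IsOpen T) (hTK : ∀ t ∈ T, ∀ q ∈ K, ⟪γ t, (q : E)⟫ ∈ I) {t : ℝ} (ht : t ∈ T) :
    HasDerivAt (fun t ↦ ∫ q, G' ⟪γ t, (q : E)⟫ * ⟪γ' t, (q : E)⟫ ∂μ)
      (∫ q, (G'' ⟪γ t, (q : E)⟫ * ⟪γ' t, (q : E)⟫ ^ 2 +
        G' ⟪γ t, (q : E)⟫ * ⟪γ'' t, (q : E)⟫) ∂μ) t := by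
  have hc : Continuous γ := continuous_iff_continuousAt.2 fun t ↦ (hγ t).continuousAt
  have hc' : Continuous γ' := continuous_iff_continuousAt.2 fun t ↦ (hγ' t).continuousAt
  have hGc : ContinuousOn G' I := fun u hu ↦ (hG' u hu).continuousAt.continuousWithinAt
  refine hasDerivAt_integral_of_continuousOn hK hK.isClosed.measurableSet hμ
    (f := fun t q ↦ G' ⟪γ t, (q : E)⟫ * ⟪γ' t, (q : E)⟫)
    (f' := fun t q ↦ G'' ⟪γ t, (q : E)⟫ * ⟪γ' t, (q : E)⟫ ^ 2 +
        G' ⟪γ t, (q : E)⟫ * ⟪γ'' t, (q : E)⟫) hT ht ?_ ?_ ?_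
  · intro s hs
    exact (hGc.comp (f := fun q : Metric.sphere (0 : E) 1 ↦ ⟪γ s, (q : E)⟫) (by fun_prop)
      (hTK s hs)).mul (by fun_prop)
  · have hu : ContinuousOn (fun z : ℝ × Metric.sphere (0 : E) 1 ↦ ⟪γ z.1, (z.2 : E)⟫) (T ×ˢ K) := by
      fun_prop
    have hm : Set.MapsTo (fun z : ℝ × Metric.sphere (0 : E) 1 ↦ ⟪γ z.1, (z.2 : E)⟫) (T ×ˢ K) I :=
      fun z hz ↦ hTK z.1 hz.1 z.2 hz.2
    exact ((hG''.comp hu hm).mul (by fun_prop)).add ((hGc.comp hu hm).mul (by fun_prop))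
  · intro s hs q hq
    have h1 := (hγ s).inner ℝ (hasDerivAt_const s (q : E))
    have h2 := (hγ' s).inner ℝ (hasDerivAt_const s (q : E))
    simp only [inner_zero_right, zero_add] at h1 h2
    have h3 := ((hG' _ (hTK s hs q hq)).comp s h1).mul h2
    convert! h3 using 1
    simp only [Function.comp_apply]
    ring

end ZonalDerivatives

section Invariance

variable {E : Type*} [NormedAddCommGroup E] [InnerProductSpace ℝ E] [MeasurableSpace E]
  [BorelSpace E] [FiniteDimensional ℝ E]

open scoped Pointwise in
lemma measurePreserving_toSphere (R : E ≃ₗᵢ[ℝ] E) :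
    MeasurePreserving (fun q : Metric.sphere (0 : E) 1 ↦
        (⟨R q, by simp⟩ : Metric.sphere (0 : E) 1))
      (volume : Measure E).toSphere (volume : Measure E).toSphere := by
  have hm : Measurable (fun q : Metric.sphere (0 : E) 1 ↦
      (⟨R q, by simp⟩ : Metric.sphere (0 : E) 1)) :=
    Continuous.measurable (by fun_prop)
  refine ⟨hm, ?_⟩
  ext s hs
  rw [Measure.map_apply hm hs, Measure.toSphere_apply' _ hs, Measure.toSphere_apply' _ (hm hs),
    ← R.measurePreserving.measure_preimage_equiv (f := R.toMeasurableEquiv)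
      (Set.Ioo (0 : ℝ) 1 • (Subtype.val '' s))]
  congr 2
  ext x
  simp only [Set.mem_smul, Set.mem_preimage]
  constructor
  · rintro ⟨r, hr, y, ⟨q, hq, rfl⟩, rfl⟩
    exact ⟨r, hr, _, ⟨_, hq, rfl⟩, by simp⟩
  · rintro ⟨r, hr, y, ⟨q, hq, rfl⟩, hx⟩
    refine ⟨r, hr, R.symm q, ⟨⟨R.symm q, by simp⟩, by simpa using hq, rfl⟩, ?_⟩
    apply R.injective
    simpa using hx

lemma setIntegral_toSphere_inner_eq (p₀ : E) {v w : E} (hvw : ‖v‖ = ‖w‖)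
    (h₀ : ⟪p₀, v⟫ = ⟪p₀, w⟫) (S : Set ℝ) (h : ℝ → ℝ) :
    ∫ q in {q : Metric.sphere (0 : E) 1 | ⟪p₀, (q : E)⟫ ∈ S}, h ⟪v, (q : E)⟫
        ∂(volume : Measure E).toSphere =
      ∫ q in {q : Metric.sphere (0 : E) 1 | ⟪p₀, (q : E)⟫ ∈ S}, h ⟪w, (q : E)⟫
        ∂(volume : Measure E).toSphere := by
  let R := Submodule.reflection (ℝ ∙ (v - w))ᗮ
  have hRv : R v = w := Submodule.reflection_sub hvw
  have hRp : R p₀ = p₀ := by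
    refine Submodule.reflection_mem_subspace_eq_self ?_
    rw [Submodule.mem_orthogonal_singleton_iff_inner_left, inner_sub_right, h₀, sub_self]
  have hsymm (x y : E) : ⟪R x, y⟫ = ⟪x, R y⟫ := by
    rw [← R.inner_map_map x, Submodule.reflection_reflection]
  let ρ : Metric.sphere (0 : E) 1 ≃ₜ Metric.sphere (0 : E) 1 :=
    { toFun := fun q ↦ ⟨R q, by simp⟩
      invFun := fun q ↦ ⟨R q, by simp⟩
      left_inv := fun q ↦ by simp [R]
      right_inv := fun q ↦ by simp [R] }
  have := (measurePreserving_toSphere R).setIntegral_preimage_emb ρ.measurableEmbedding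
    (fun q ↦ h ⟪v, (q : E)⟫) {q : Metric.sphere (0 : E) 1 | ⟪p₀, (q : E)⟫ ∈ S}
  rw [← this]
  simp [← hsymm, hRv, hRp]

end Invariance

section ZonalRelation

variable {E : Type*} [NormedAddCommGroup E] [InnerProductSpace ℝ E] {p₀ : E} {a : ℝ}

lemma norm_cos_smul_add_sin_smul {x y : E} (hx : ‖x‖ = 1) (hy : ‖y‖ = 1) (hxy : ⟪x, y⟫ = 0)
    (θ : ℝ) : ‖cos θ • x + sin θ • y‖ = 1 := by
  rw [← pow_eq_one_iff_of_nonneg (norm_nonneg _) two_ne_zero, ← real_inner_self_eq_norm_sq]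
  simp only [inner_add_right, inner_add_left, inner_smul_right, inner_smul_left, hxy,
    real_inner_comm x y, real_inner_self_eq_norm_sq, hx, hy, RCLike.conj_to_real]
  linear_combination sin_sq_add_cos_sq θ

lemma isCompact_setOf_le_inner [FiniteDimensional ℝ E] (p₀ : E) (c : ℝ) :
    IsCompact {q : Metric.sphere (0 : E) 1 | c ≤ ⟪p₀, (q : E)⟫} :=
  (isClosed_le continuous_const (by fun_prop)).isCompact

lemma inner_mem_Icc_of_norm_eq_one {v : E} (hv : ‖v‖ = 1) (q : Metric.sphere (0 : E) 1) :
    ⟪v, (q : E)⟫ ∈ Set.Icc (-1 : ℝ) 1 := by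
  have h := abs_real_inner_le_norm v (q : E)
  rw [hv, norm_eq_of_mem_sphere, one_mul] at h
  exact abs_le.1 h

lemma cos_le_inner_of_arccos_inner_lt (hp₀ : ‖p₀‖ = 1) (ha : a ≤ π)
    {q : Metric.sphere (0 : E) 1} (hq : arccos ⟪p₀, (q : E)⟫ < a) : cos a ≤ ⟪p₀, (q : E)⟫ := by
  have h := inner_mem_Icc_of_norm_eq_one hp₀ q
  rw [← cos_arccos h.1 h.2]
  exact cos_le_cos_of_nonneg_of_le_pi (arccos_nonneg _) ha hq.le

lemma inner_mem_Ioo_of_inner_lt {v : E} {c : ℝ} (hv : ‖v‖ = 1) (hvc : ⟪p₀, v⟫ < c)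
    {q : Metric.sphere (0 : E) 1} (hq : c ≤ ⟪p₀, (q : E)⟫) :
    ⟪v, (q : E)⟫ ∈ Set.Ioo (-3 : ℝ) 1 := by
  have h := inner_mem_Icc_of_norm_eq_one hv q
  refine ⟨by linarith [h.1], h.2.lt_of_ne fun h1 ↦ ?_⟩
  rw [inner_eq_one_iff_of_norm_eq_one hv (norm_eq_of_mem_sphere q)] at h1
  rw [h1] at hvc
  linarith

variable [MeasurableSpace E] [BorelSpace E] [FiniteDimensional ℝ E]

/-- The surface measure of the unit sphere restricted to the geodesic ball of radius `a`
around `p₀`. -/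
noncomputable def capMeasure (p₀ : E) (a : ℝ) : Measure (Metric.sphere (0 : E) 1) :=
  (volume : Measure E).toSphere.restrict {q | arccos ⟪p₀, (q : E)⟫ < a}

instance : IsFiniteMeasure (capMeasure p₀ a) := by unfold capMeasure; infer_instance

lemma measurableSet_arccos_inner_lt (p₀ : E) (a : ℝ) :
    MeasurableSet {q : Metric.sphere (0 : E) 1 | arccos ⟪p₀, (q : E)⟫ < a} :=
  measurableSet_lt (by fun_prop) (by fun_prop)

lemma ae_capMeasure_mem (hp₀ : ‖p₀‖ = 1) (ha : a ≤ π) :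
    ∀ᵐ q ∂(capMeasure p₀ a), q ∈ {q : Metric.sphere (0 : E) 1 | cos a ≤ ⟪p₀, (q : E)⟫} :=
  (ae_restrict_mem (measurableSet_arccos_inner_lt p₀ a)).mono
    fun _ hq ↦ cos_le_inner_of_arccos_inner_lt hp₀ ha hq

variable {G G' G'' : ℝ → ℝ}

lemma sin_sq_mul_integral_capMeasure (ha : a ≤ π)
    (hG : ∀ u ∈ Set.Ioo (-3 : ℝ) 1, HasDerivAt G (G' u) u)
    (hG' : ∀ u ∈ Set.Ioo (-3 : ℝ) 1, HasDerivAt G' (G'' u) u)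
    (hG'' : ContinuousOn G'' (Set.Ioo (-3 : ℝ) 1))
    {e f : E} (hp₀ : ‖p₀‖ = 1) (he : ‖e‖ = 1) (hf : ‖f‖ = 1) (hpe : ⟪p₀, e⟫ = 0)
    (hpf : ⟪p₀, f⟫ = 0) (hef : ⟪e, f⟫ = 0) {θ : ℝ} (hθ : cos θ < cos a) :
    sin θ ^ 2 * ∫ q, G'' ⟪cos θ • p₀ + sin θ • e, (q : E)⟫ * ⟪f, (q : E)⟫ ^ 2 ∂(capMeasure p₀ a) =
      sin θ * ∫ q, G' ⟪cos θ • p₀ + sin θ • e, (q : E)⟫ * ⟪e, (q : E)⟫ ∂(capMeasure p₀ a) := by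
  let γ : ℝ → E := fun t ↦ cos θ • p₀ + sin θ • (cos t • e + sin t • f)
  let γ' : ℝ → E := fun t ↦ sin θ • (-sin t • e + cos t • f)
  let γ'' : ℝ → E := fun t ↦ -(sin θ • (cos t • e + sin t • f))
  have hγ (t) : HasDerivAt γ (γ' t) t :=
    ((((hasDerivAt_cos t).smul_const e).add ((hasDerivAt_sin t).smul_const f)).const_smul
      (sin θ)).const_add _
  have hγ' (t) : HasDerivAt γ' (γ'' t) t := by
    convert! (((hasDerivAt_sin t).neg.smul_const e).add
      ((hasDerivAt_cos t).smul_const f)).const_smul (sin θ) using 1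
    simp only [γ'']
    module
  have hpγ (t) : ⟪p₀, γ t⟫ = cos θ := by
    simp [γ, inner_add_right, inner_smul_right, hpe, hpf, hp₀]
  have hnγ (t) : ‖γ t‖ = 1 :=
    norm_cos_smul_add_sin_smul hp₀ (norm_cos_smul_add_sin_smul he hf hef t)
      (by simp [inner_add_right, inner_smul_right, hpe, hpf]) θ
  have hK := isCompact_setOf_le_inner p₀ (cos a)
  have hμ := ae_capMeasure_mem hp₀ ha
  have hTK : ∀ t ∈ Set.univ, ∀ q ∈ {q : Metric.sphere (0 : E) 1 | cos a ≤ ⟪p₀, (q : E)⟫},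
      ⟪γ t, (q : E)⟫ ∈ Set.Ioo (-3 : ℝ) 1 := fun t _ q hq ↦
    inner_mem_Ioo_of_inner_lt (hnγ t) (by rw [hpγ]; exact hθ) hq
  have hconst (t) : ∫ q, G ⟪γ t, (q : E)⟫ ∂(capMeasure p₀ a) =
      ∫ q, G ⟪γ 0, (q : E)⟫ ∂(capMeasure p₀ a) :=
    setIntegral_toSphere_inner_eq p₀ (by rw [hnγ, hnγ]) (by rw [hpγ, hpγ]) {u | arccos u < a} G
  have h1 (t) : ∫ q, G' ⟪γ t, (q : E)⟫ * ⟪γ' t, (q : E)⟫ ∂(capMeasure p₀ a) = 0 := by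
    refine (hasDerivAt_integral_comp_inner hK hμ hG
      (fun u hu ↦ (hG' u hu).continuousAt.continuousWithinAt) hγ (by fun_prop) isOpen_univ hTK
      (Set.mem_univ t)).unique ?_
    simp_rw [hconst]
    exact hasDerivAt_const _ _
  have h2 := hasDerivAt_integral_comp_inner_mul hK hμ hG' hG'' hγ hγ' (by fun_prop) isOpen_univ hTK
      (Set.mem_univ 0)
  simp_rw [h1] at h2
  have h3 := h2.unique (hasDerivAt_const _ _)
  have hγ0 : γ 0 = cos θ • p₀ + sin θ • e := by simp [γ]
  have hγ'0 : γ' 0 = sin θ • f := by simp [γ']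
  have hγ''0 : γ'' 0 = -(sin θ • e) := by simp [γ'']
  have hI := hTK 0 (Set.mem_univ 0)
  rw [hγ'0, hγ''0] at h3
  rw [← hγ0]
  have hu : ContinuousOn (fun q : Metric.sphere (0 : E) 1 ↦ ⟪γ 0, (q : E)⟫)
    {q : Metric.sphere (0 : E) 1 | cos a ≤ ⟪p₀, (q : E)⟫} := by fun_prop
  have hc' := ContinuousOn.comp (fun u hu ↦ (hG' u hu).continuousAt.continuousWithinAt) hu hI
  have hc'' := hG''.comp hu hI
  rw [integral_add] at h3
  · simp only [inner_neg_left, inner_smul_left, RCLike.conj_to_real, mul_neg, mul_pow,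
      integral_neg] at h3
    rw [← integral_const_mul, ← integral_const_mul]
    rw [add_neg_eq_zero] at h3
    simp_rw [mul_left_comm (G'' _), mul_left_comm (G' _)] at h3
    exact h3
  · exact integrable_of_continuousOn_of_ae_mem hK hK.isClosed.measurableSet hμ
      (hc''.mul (by fun_prop))
  · exact integrable_of_continuousOn_of_ae_mem hK hK.isClosed.measurableSet hμ
      (hc'.mul (by fun_prop))

lemma sin_mul_integral_capMeasure_add (ha : a ≤ π)
    (hG : ∀ u ∈ Set.Ioo (-3 : ℝ) 1, HasDerivAt G (G' u) u)
    (hG' : ∀ u ∈ Set.Ioo (-3 : ℝ) 1, HasDerivAt G' (G'' u) u)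
    (hG'' : ContinuousOn G'' (Set.Ioo (-3 : ℝ) 1)) {m : ℕ} {C : ℝ}
    (hode : ∀ u ∈ Set.Ioo (-3 : ℝ) 1, (1 - u ^ 2) * G'' u - (m + 1) * u * G' u = C)
    (b : OrthonormalBasis (Fin (m + 2)) ℝ E) {θ : ℝ} (hθ : cos θ < cos a) (hsθ : 0 < sin θ)
    {v w : E} (hv : v = cos θ • b 0 + sin θ • b 1) (hw : w = -sin θ • b 0 + cos θ • b 1) :
    sin θ * ∫ q, (G'' ⟪v, (q : E)⟫ * ⟪w, (q : E)⟫ ^ 2 + G' ⟪v, (q : E)⟫ * ⟪-v, (q : E)⟫)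
        ∂(capMeasure (b 0) a)
      + m * cos θ * ∫ q, G' ⟪v, (q : E)⟫ * ⟪w, (q : E)⟫ ∂(capMeasure (b 0) a) =
      sin θ * (C * (capMeasure (b 0) a).real Set.univ) := by
  have hb (i j : Fin (m + 2)) : ⟪b i, b j⟫ = if i = j then 1 else 0 :=
    orthonormal_iff_ite.1 b.orthonormal i j
  have hn (i : Fin (m + 2)) : ‖b i‖ = 1 := b.orthonormal.1 i
  have hpv : ⟪b 0, v⟫ = cos θ := by
    simp [hv, inner_add_right, inner_smul_right, hb]
  have hnv : ‖v‖ = 1 := hv ▸ norm_cos_smul_add_sin_smul (hn 0) (hn 1) (by simp [hb]) θ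
  have hK := isCompact_setOf_le_inner (b 0) (cos a)
  have hμ := ae_capMeasure_mem (hn 0) ha
  have hI : ∀ q ∈ {q : Metric.sphere (0 : E) 1 | cos a ≤ ⟪b 0, (q : E)⟫},
      ⟪v, (q : E)⟫ ∈ Set.Ioo (-3 : ℝ) 1 := fun q hq ↦
    inner_mem_Ioo_of_inner_lt hnv (by rw [hpv]; exact hθ) hq
  have hu : ContinuousOn (fun q : Metric.sphere (0 : E) 1 ↦ ⟪v, (q : E)⟫)
    {q : Metric.sphere (0 : E) 1 | cos a ≤ ⟪b 0, (q : E)⟫} := by fun_prop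
  have hc' := ContinuousOn.comp (fun u hu ↦ (hG' u hu).continuousAt.continuousWithinAt) hu hI
  have hc'' := hG''.comp hu hI
  have int' {F : Metric.sphere (0 : E) 1 → ℝ} (hF : Continuous F) :
      Integrable (fun q : Metric.sphere (0 : E) 1 ↦ G' ⟪v, (q : E)⟫ * F q) (capMeasure (b 0) a) :=
    integrable_of_continuousOn_of_ae_mem hK hK.isClosed.measurableSet hμ (hc'.mul hF.continuousOn)
  have int'' {F : Metric.sphere (0 : E) 1 → ℝ} (hF : Continuous F) :
      Integrable (fun q : Metric.sphere (0 : E) 1 ↦ G'' ⟪v, (q : E)⟫ * F q) (capMeasure (b 0) a) :=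
    integrable_of_continuousOn_of_ae_mem hK hK.isClosed.measurableSet hμ (hc''.mul hF.continuousOn)
  have hrot (i : Fin m) := sin_sq_mul_integral_capMeasure (f := b i.succ.succ) ha hG hG' hG'' (hn 0)
    (hn 1) (hn _) (by simp [hb]) (by simp [hb, Fin.ext_iff]) (by simp [hb, Fin.ext_iff]) hθ
  rw [← hv] at hrot
  have hsum : ∀ q : Metric.sphere (0 : E) 1, ⟪v, (q : E)⟫ ^ 2 + ⟪w, (q : E)⟫ ^ 2 +
      ∑ i : Fin m, ⟪b i.succ.succ, (q : E)⟫ ^ 2 = 1 := by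
    intro q
    have h := b.sum_sq_inner_right (q : E)
    rw [Fin.sum_univ_succ, Fin.sum_univ_succ, norm_eq_of_mem_sphere] at h
    simp only [hv, hw, inner_add_left, inner_smul_left, RCLike.conj_to_real, Fin.succ_zero_eq_one]
      at h ⊢
    linear_combination h + (⟪b 0, (q : E)⟫ ^ 2 + ⟪b 1, (q : E)⟫ ^ 2) * sin_sq_add_cos_sq θ
  have hint : ∫ q, (G'' ⟪v, (q : E)⟫ * ⟪w, (q : E)⟫ ^ 2 +
      ∑ i : Fin m, G'' ⟪v, (q : E)⟫ * ⟪b i.succ.succ, (q : E)⟫ ^ 2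
      - (m + 1) * (G' ⟪v, (q : E)⟫ * ⟪v, (q : E)⟫)) ∂(capMeasure (b 0) a) =
      C * (capMeasure (b 0) a).real Set.univ := by
    rw [mul_comm, ← smul_eq_mul, ← integral_const]
    refine integral_congr_ae (hμ.mono fun q hq ↦ ?_)
    beta_reduce
    rw [← Finset.mul_sum]
    linear_combination hode _ (hI q hq) + G'' ⟪v, (q : E)⟫ * hsum q
  rw [integral_sub (by exact ((int'' (by fun_prop)).add
      (integrable_finsetSum _ fun i _ ↦ int'' (by fun_prop)))) ((int' (by fun_prop)).const_mul _),
    integral_add (int'' (by fun_prop)) (integrable_finsetSum _ fun i _ ↦ int'' (by fun_prop)),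
    integral_finsetSum _ (fun i _ ↦ int'' (by fun_prop)), integral_const_mul] at hint
  have he (q : Metric.sphere (0 : E) 1) :
      ⟪b 1, (q : E)⟫ = sin θ * ⟪v, (q : E)⟫ + cos θ * ⟪w, (q : E)⟫ := by
    simp only [hv, hw, inner_add_left, inner_smul_left, RCLike.conj_to_real]
    linear_combination -⟪b 1, (q : E)⟫ * sin_sq_add_cos_sq θ
  have hrot' (i : Fin m) :
      sin θ * ∫ q, G'' ⟪v, (q : E)⟫ * ⟪b i.succ.succ, (q : E)⟫ ^ 2 ∂(capMeasure (b 0) a) =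
      sin θ * ∫ q, G' ⟪v, (q : E)⟫ * ⟪v, (q : E)⟫ ∂(capMeasure (b 0) a) +
      cos θ * ∫ q, G' ⟪v, (q : E)⟫ * ⟪w, (q : E)⟫ ∂(capMeasure (b 0) a) := by
    rw [← integral_const_mul, ← integral_const_mul, ← integral_const_mul (cos θ),
      ← integral_add ((int' (by fun_prop)).const_mul _) ((int' (by fun_prop)).const_mul _)]
    refine mul_left_cancel₀ hsθ.ne' ?_
    rw [integral_const_mul, ← mul_assoc, ← sq, hrot]
    congr 2 with q
    rw [he]
    ring
  rw [integral_add (int'' (by fun_prop)) (int' (by fun_prop))]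
  simp only [inner_neg_left, mul_neg, integral_neg]
  rw [← hint, mul_sub, mul_add (sin θ) (∫ _, _ ∂_) (∑ _, _), Finset.mul_sum,
    Finset.sum_congr rfl fun i _ ↦ hrot' i]
  simp
  ring

end ZonalRelation

section MeanValue

variable {E : Type*} [NormedAddCommGroup E] [InnerProductSpace ℝ E] {p₀ : E} {a : ℝ}
  [MeasurableSpace E] [BorelSpace E] [FiniteDimensional ℝ E] {G G' G'' : ℝ → ℝ}

lemma integral_capMeasure_comp_inner_basis (ha : a ∈ Set.Ioo 0 π)
    (hG : ∀ u ∈ Set.Ioo (-3 : ℝ) 1, HasDerivAt G (G' u) u)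
    (hG' : ∀ u ∈ Set.Ioo (-3 : ℝ) 1, HasDerivAt G' (G'' u) u)
    (hG'' : ContinuousOn G'' (Set.Ioo (-3 : ℝ) 1)) {m : ℕ} (hm : m ≠ 0) {C : ℝ}
    (hode : ∀ u ∈ Set.Ioo (-3 : ℝ) 1, (1 - u ^ 2) * G'' u - (m + 1) * u * G' u = C)
    (b : OrthonormalBasis (Fin (m + 2)) ℝ E) {θ : ℝ} (hθ : θ ∈ Set.Ioc a π) :
    ∫ q, G ⟪cos θ • b 0 + sin θ • b 1, (q : E)⟫ ∂(capMeasure (b 0) a) =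
      (capMeasure (b 0) a).real Set.univ * G (cos θ) +
        (∫ q, G ⟪-b 0, (q : E)⟫ ∂(capMeasure (b 0) a) -
          (capMeasure (b 0) a).real Set.univ * G (-1)) := by
  set V := (capMeasure (b 0) a).real Set.univ
  let T : Set ℝ := {t | cos t < cos a}
  have hT : IsOpen T := isOpen_lt continuous_cos continuous_const
  have hIoc {t : ℝ} (ht : t ∈ Set.Ioc a π) : t ∈ T :=
    cos_lt_cos_of_nonneg_of_le_pi ha.1.le ht.2 ht.1
  let γ : ℝ → E := fun t ↦ cos t • b 0 + sin t • b 1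
  let γ' : ℝ → E := fun t ↦ -sin t • b 0 + cos t • b 1
  have hγ (t) : HasDerivAt γ (γ' t) t :=
    ((hasDerivAt_cos t).smul_const _).add ((hasDerivAt_sin t).smul_const _)
  have hγ' (t) : HasDerivAt γ' (-γ t) t := by
    convert! ((hasDerivAt_sin t).neg.smul_const (b 0)).add
      ((hasDerivAt_cos t).smul_const (b 1)) using 1
    simp only [γ]
    module
  have hb (i j : Fin (m + 2)) : ⟪b i, b j⟫ = if i = j then 1 else 0 :=
    orthonormal_iff_ite.1 b.orthonormal i j
  have hn (i : Fin (m + 2)) : ‖b i‖ = 1 := b.orthonormal.1 i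
  have hTK : ∀ t ∈ T, ∀ q ∈ {q : Metric.sphere (0 : E) 1 | cos a ≤ ⟪b 0, (q : E)⟫},
      ⟪γ t, (q : E)⟫ ∈ Set.Ioo (-3 : ℝ) 1 := fun t ht q hq ↦
    inner_mem_Ioo_of_inner_lt (norm_cos_smul_add_sin_smul (hn 0) (hn 1) (by simp [hb]) t)
      (by simpa [γ, inner_add_right, inner_smul_right, hb, T] using ht) hq
  have hcos {t : ℝ} (ht : t ∈ T) : cos t ∈ Set.Ioo (-3 : ℝ) 1 :=
    ⟨by linarith [neg_one_le_cos t], lt_of_lt_of_le ht (cos_le_one a)⟩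
  have hK := isCompact_setOf_le_inner (b 0) (cos a)
  have hμ := ae_capMeasure_mem (hn 0) ha.2.le
  let H₁ : ℝ → ℝ := fun t ↦ ∫ q, G' ⟪γ t, (q : E)⟫ * ⟪γ' t, (q : E)⟫ ∂(capMeasure (b 0) a)
  let H₂ : ℝ → ℝ := fun t ↦ ∫ q, (G'' ⟪γ t, (q : E)⟫ * ⟪γ' t, (q : E)⟫ ^ 2 +
    G' ⟪γ t, (q : E)⟫ * ⟪-γ t, (q : E)⟫) ∂(capMeasure (b 0) a)
  let P : ℝ → ℝ := fun t ↦ H₁ t + V * (G' (cos t) * sin t)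
  have hH {t : ℝ} (ht : t ∈ T) :
      HasDerivAt (fun t ↦ ∫ q, G ⟪γ t, (q : E)⟫ ∂(capMeasure (b 0) a)) (H₁ t) t :=
    hasDerivAt_integral_comp_inner hK hμ hG
      (fun u hu ↦ (hG' u hu).continuousAt.continuousWithinAt) hγ (by fun_prop) hT hTK ht
  have hH₁ {t : ℝ} (ht : t ∈ T) : HasDerivAt H₁ (H₂ t) t :=
    hasDerivAt_integral_comp_inner_mul hK hμ hG' hG'' hγ hγ' (by fun_prop) hT hTK ht
  have hP {t : ℝ} (ht : t ∈ T) : HasDerivAt P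
      (H₂ t + V * (G'' (cos t) * -sin t * sin t + G' (cos t) * cos t)) t :=
    (hH₁ ht).add ((((hG' _ (hcos ht)).comp t (hasDerivAt_cos t)).mul
      (hasDerivAt_sin t)).const_mul V)
  have hW {t : ℝ} (ht : t ∈ Set.Ioo a π) : HasDerivAt (fun t ↦ sin t ^ m * P t) 0 t := by
    have hs : 0 < sin t := sin_pos_of_pos_of_lt_pi (ha.1.trans ht.1) ht.2
    have htT := hIoc ⟨ht.1, ht.2.le⟩
    convert! ((hasDerivAt_sin t).pow m).mul (hP htT) using 1
    have h1 := sin_mul_integral_capMeasure_add ha.2.le hG hG' hG'' hode b htT hs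
      (v := γ t) (w := γ' t) rfl rfl
    have h2 := hode _ (hcos htT)
    obtain ⟨k, rfl⟩ := Nat.exists_eq_succ_of_ne_zero hm
    change sin t * H₂ t + _ * H₁ t = sin t * (C * V) at h1
    simp only [P, Nat.succ_eq_add_one, Nat.add_sub_cancel, Pi.pow_apply] at h1 h2 ⊢
    push_cast at h1 h2 ⊢
    linear_combination (-sin t ^ k) * h1 + sin t ^ (k + 1) * V * h2
      + sin t ^ (k + 1) * V * G'' (cos t) * sin_sq_add_cos_sq t
  have hP0 {t : ℝ} (ht : t ∈ Set.Ioo a π) : P t = 0 := by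
    have hs : 0 < sin t := sin_pos_of_pos_of_lt_pi (ha.1.trans ht.1) ht.2
    have h := constant_of_has_deriv_right_zero (f := fun t ↦ sin t ^ m * P t) (a := t) (b := π)
      (fun x hx ↦ ((continuous_sin.continuousAt.pow m).mul
        (hP (hIoc ⟨ht.1.trans_le hx.1, hx.2⟩)).continuousAt).continuousWithinAt)
      (fun x hx ↦ (hW ⟨ht.1.trans_le hx.1, hx.2⟩).hasDerivWithinAt) π ⟨ht.2.le, le_rfl⟩
    simpa [hm, hs.ne'] using h.symm
  have hD {t : ℝ} (ht : t ∈ Set.Ioc a π) :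
      HasDerivAt (fun t ↦ ∫ q, G ⟪γ t, (q : E)⟫ ∂(capMeasure (b 0) a) - V * G (cos t)) (P t) t := by
    convert! (hH (hIoc ht)).sub
      (((hG _ (hcos (hIoc ht))).comp t (hasDerivAt_cos t)).const_mul V) using 1
    simp only [P]
    ring
  have h := constant_of_has_deriv_right_zero (a := θ) (b := π)
    (fun x hx ↦ (hD ⟨hθ.1.trans_le hx.1, hx.2⟩).continuousAt.continuousWithinAt)
    (fun x hx ↦ (hP0 ⟨hθ.1.trans_le hx.1, hx.2⟩ ▸
      hD ⟨hθ.1.trans_le hx.1, hx.2.le⟩).hasDerivWithinAt) π ⟨hθ.2, le_rfl⟩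
  simp only [γ, cos_pi, sin_pi, zero_smul, add_zero, neg_smul, one_smul] at h
  linarith

lemma integral_capMeasure_comp_inner_of_lt (ha : a ∈ Set.Ioo 0 π)
    (hG : ∀ u ∈ Set.Ioo (-3 : ℝ) 1, HasDerivAt G (G' u) u)
    (hG' : ∀ u ∈ Set.Ioo (-3 : ℝ) 1, HasDerivAt G' (G'' u) u)
    (hG'' : ContinuousOn G'' (Set.Ioo (-3 : ℝ) 1)) {n : ℕ} (hn : 2 ≤ n) {C : ℝ}
    (hode : ∀ u ∈ Set.Ioo (-3 : ℝ) 1, (1 - u ^ 2) * G'' u - n * u * G' u = C)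
    (hE : Module.finrank ℝ E = n + 1) {p : E} (hp₀ : ‖p₀‖ = 1) (hp : ‖p‖ = 1)
    (hpa : a < arccos ⟪p₀, p⟫) :
    ∫ q, G ⟪p, (q : E)⟫ ∂(capMeasure p₀ a) =
      (capMeasure p₀ a).real Set.univ * G ⟪p₀, p⟫ +
        (∫ q, G ⟪-p₀, (q : E)⟫ ∂(capMeasure p₀ a) -
          (capMeasure p₀ a).real Set.univ * G (-1)) := by
  have hu := inner_mem_Icc_of_norm_eq_one hp₀ ⟨p, by simpa using hp⟩
  simp only at hu
  set θ := arccos ⟪p₀, p⟫ with hθ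
  have hcos : cos θ = ⟪p₀, p⟫ := cos_arccos hu.1 hu.2
  rcases eq_or_lt_of_le (arccos_le_pi ⟪p₀, p⟫) with hpi | hpi
  · have h1 : ⟪p₀, p⟫ = -1 := by rw [← hcos, hθ, hpi, cos_pi]
    have h2 : p = -p₀ := by
      have := (inner_eq_one_iff_of_norm_eq_one (𝕜 := ℝ) (by rwa [norm_neg]) hp).1
        (show ⟪-p₀, p⟫ = 1 by rw [inner_neg_left, h1, neg_neg])
      exact this.symm
    rw [h1, h2]
    ring
  have hs : 0 < sin θ := sin_pos_of_pos_of_lt_pi (ha.1.trans hpa) hpi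
  let e : E := (sin θ)⁻¹ • (p - cos θ • p₀)
  have hpe : ⟪p₀, e⟫ = 0 := by
    simp [e, inner_smul_right, inner_sub_right, hp₀, hcos]
  have hpv : p = cos θ • p₀ + sin θ • e := by
    simp [e, smul_smul, hs.ne']
  have he : ‖e‖ = 1 := by
    rw [← pow_eq_one_iff_of_nonneg (norm_nonneg _) two_ne_zero, ← real_inner_self_eq_norm_sq]
    have h1 : ⟪p - cos θ • p₀, p - cos θ • p₀⟫ = sin θ ^ 2 := by
      simp only [inner_sub_left, inner_sub_right, inner_smul_left, inner_smul_right,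
        real_inner_comm p₀ p, real_inner_self_eq_norm_sq, hp, hp₀, ← hcos, RCLike.conj_to_real]
      linear_combination -sin_sq_add_cos_sq θ
    simp only [e, inner_smul_left, inner_smul_right, h1, RCLike.conj_to_real]
    field_simp
  obtain ⟨m, rfl⟩ : ∃ m, n = m + 1 := ⟨n - 1, by omega⟩
  obtain ⟨b, hb⟩ := Orthonormal.exists_orthonormalBasis_extension_of_card_eq (𝕜 := ℝ)
    (ι := Fin (m + 2)) (by simpa using hE) (v := fun i ↦ if i = 0 then p₀ else e) (s := {0, 1}) (by
      rw [orthonormal_iff_ite]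
      rintro ⟨i, hi⟩ ⟨j, hj⟩
      have hep : ⟪e, p₀⟫ = 0 := by rw [real_inner_comm, hpe]
      rcases hi with rfl | rfl <;> rcases hj with rfl | rfl <;>
        simp [hp₀, he, hpe, hep, Subtype.ext_iff])
  have hb0 : b 0 = p₀ := by simpa using hb 0 (by simp)
  have hb1 : b 1 = e := by simpa using hb 1 (by simp)
  have := integral_capMeasure_comp_inner_basis ha hG hG' hG'' (m := m) (by omega) (C := C)
    (by simpa using hode) b (θ := θ) ⟨hpa, hpi.le⟩
  rwa [hb0, hb1, ← hpv, hcos] at this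

lemma integrable_capMeasure_comp_inner (ha : a ≤ π) (hG : ContinuousOn G (Set.Ioo (-3 : ℝ) 1))
    {p : E} (hp₀ : ‖p₀‖ = 1) (hp : ‖p‖ = 1) (hpa : ⟪p₀, p⟫ < cos a) :
    Integrable (fun q : Metric.sphere (0 : E) 1 ↦ G ⟪p, (q : E)⟫) (capMeasure p₀ a) := by
  have hK := isCompact_setOf_le_inner p₀ (cos a)
  exact integrable_of_continuousOn_of_ae_mem hK hK.isClosed.measurableSet (ae_capMeasure_mem hp₀ ha)
    (hG.comp (by fun_prop) fun q hq ↦ inner_mem_Ioo_of_inner_lt hp hpa hq)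

lemma capMeasure_restrict {b : ℝ} (hba : b ≤ a) :
    (capMeasure p₀ a).restrict {q | arccos ⟪p₀, (q : E)⟫ < b} = capMeasure p₀ b := by
  have h : {q : Metric.sphere (0 : E) 1 | arccos ⟪p₀, (q : E)⟫ < b} ⊆
      {q | arccos ⟪p₀, (q : E)⟫ < a} := fun _ hq ↦ lt_of_lt_of_le hq hba
  rw [capMeasure, Measure.restrict_restrict (measurableSet_arccos_inner_lt p₀ b),
    Set.inter_eq_left.2 h, capMeasure]

lemma integral_capMeasure_comp_inner (ha : a ∈ Set.Ioo 0 π)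
    (hG : ∀ u ∈ Set.Ioo (-3 : ℝ) 1, HasDerivAt G (G' u) u)
    (hG' : ∀ u ∈ Set.Ioo (-3 : ℝ) 1, HasDerivAt G' (G'' u) u)
    (hG'' : ContinuousOn G'' (Set.Ioo (-3 : ℝ) 1)) (hG0 : ∀ u ∈ Set.Ico (-1 : ℝ) 1, 0 ≤ G u)
    {n : ℕ} (hn : 2 ≤ n) {C : ℝ}
    (hode : ∀ u ∈ Set.Ioo (-3 : ℝ) 1, (1 - u ^ 2) * G'' u - n * u * G' u = C)
    (hE : Module.finrank ℝ E = n + 1) {p : E} (hp₀ : ‖p₀‖ = 1) (hp : ‖p‖ = 1)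
    (hpa : a ≤ arccos ⟪p₀, p⟫) :
    Integrable (fun q : Metric.sphere (0 : E) 1 ↦ G ⟪p, (q : E)⟫) (capMeasure p₀ a) ∧
    ∫ q, G ⟪p, (q : E)⟫ ∂(capMeasure p₀ a) =
      ∫ q, (G ⟪p₀, p⟫ + (G ⟪-p₀, (q : E)⟫ - G (-1))) ∂(capMeasure p₀ a) := by
  have hGc : ContinuousOn G (Set.Ioo (-3 : ℝ) 1) :=
    fun u hu ↦ (hG u hu).continuousAt.continuousWithinAt
  have hu := inner_mem_Icc_of_norm_eq_one hp₀ ⟨p, by simpa using hp⟩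
  simp only at hu
  obtain ⟨b, -, hb, hblim⟩ := exists_seq_strictMono_tendsto' ha.1
  have hcov : AECover (capMeasure p₀ a) atTop
      fun k ↦ {q : Metric.sphere (0 : E) 1 | arccos ⟪p₀, (q : E)⟫ < b k} :=
    ⟨(ae_restrict_mem (measurableSet_arccos_inner_lt p₀ a)).mono
      fun q hq ↦ hblim.eventually_const_lt hq, fun k ↦ measurableSet_arccos_inner_lt p₀ (b k)⟩
  have hanti {b : ℝ} (hb : b ∈ Set.Ioc 0 a) : Integrable
      (fun q : Metric.sphere (0 : E) 1 ↦ G ⟪-p₀, (q : E)⟫) (capMeasure p₀ b) := by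
    refine integrable_capMeasure_comp_inner (hb.2.trans ha.2.le) hGc hp₀ (by rwa [norm_neg]) ?_
    rw [inner_neg_right, real_inner_self_eq_norm_sq, hp₀, one_pow, ← cos_pi]
    exact cos_lt_cos_of_nonneg_of_le_pi hb.1.le le_rfl (hb.2.trans_lt ha.2)
  have hR := (integrable_const (G ⟪p₀, p⟫)).add
    ((hanti ⟨ha.1, le_rfl⟩).sub (integrable_const (G (-1))))
  have hlim := hcov.integral_tendsto_of_countably_generated hR
  have hfi (k : ℕ) : IntegrableOn (fun q : Metric.sphere (0 : E) 1 ↦ G ⟪p, (q : E)⟫)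
      {q | arccos ⟪p₀, (q : E)⟫ < b k} (capMeasure p₀ a) := by
    rw [IntegrableOn, capMeasure_restrict (hb k).2.le]
    refine integrable_capMeasure_comp_inner ((hb k).2.trans ha.2).le hGc hp₀ hp ?_
    rw [← cos_arccos hu.1 hu.2]
    exact cos_lt_cos_of_nonneg_of_le_pi (hb k).1.le (arccos_le_pi _) ((hb k).2.trans_le hpa)
  have hnn : 0 ≤ᵐ[capMeasure p₀ a] fun q : Metric.sphere (0 : E) 1 ↦ G ⟪p, (q : E)⟫ := by
    filter_upwards [ae_restrict_mem (measurableSet_arccos_inner_lt p₀ a)] with q hq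
    have h := inner_mem_Icc_of_norm_eq_one hp q
    refine hG0 _ ⟨h.1, h.2.lt_of_ne fun h1 ↦ ?_⟩
    rw [inner_eq_one_iff_of_norm_eq_one hp (norm_eq_of_mem_sphere q)] at h1
    rw [h1] at hpa
    exact hpa.not_gt hq
  have heq (k : ℕ) : ∫ q in {q : Metric.sphere (0 : E) 1 | arccos ⟪p₀, (q : E)⟫ < b k},
      (G ⟪p₀, p⟫ + (G ⟪-p₀, (q : E)⟫ - G (-1))) ∂(capMeasure p₀ a) =
      ∫ q in {q : Metric.sphere (0 : E) 1 | arccos ⟪p₀, (q : E)⟫ < b k},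
        G ⟪p, (q : E)⟫ ∂(capMeasure p₀ a) := by
    have hI := hanti ⟨(hb k).1, (hb k).2.le⟩
    rw [capMeasure_restrict (hb k).2.le, integral_capMeasure_comp_inner_of_lt
      ⟨(hb k).1, (hb k).2.trans ha.2⟩ hG hG' hG'' hn hode hE hp₀ hp ((hb k).2.trans_le hpa),
      integral_add (integrable_const _) (by exact hI.sub (integrable_const _)),
      integral_sub hI (integrable_const _), integral_const, integral_const, smul_eq_mul,
      smul_eq_mul]
  have hlim' := hlim.congr heq
  exact ⟨hcov.integrable_of_integral_tendsto_of_nonneg_ae _ hfi hnn hlim',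
    hcov.integral_eq_of_tendsto_of_nonneg_ae _ hnn hfi hlim'⟩

end MeanValue

section PowerSeries

/-- The coefficients of the derivative of the power series with coefficients `a`. -/
def derivCoeff (a : ℕ → ℝ) (k : ℕ) : ℝ := (k + 1) * a (k + 1)

variable {a : ℕ → ℝ}

lemma derivCoeff_pos (ha : ∀ k, 0 < a k) (k : ℕ) : 0 < derivCoeff a k :=
  mul_pos (by positivity) (ha _)

lemma tendsto_nat_add_div_nat_add (x y : ℝ) :
    Tendsto (fun k : ℕ ↦ ((k : ℝ) + x) / (k + y)) atTop (nhds 1) := by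
  simpa [add_comm] using tendsto_add_mul_div_add_mul_atTop_nhds x y (1 : ℝ) (one_ne_zero (α := ℝ))

lemma tendsto_derivCoeff_div (hlim : Tendsto (fun k ↦ a (k + 1) / a k) atTop (nhds 1)) :
    Tendsto (fun k ↦ derivCoeff a (k + 1) / derivCoeff a k) atTop (nhds 1) := by
  have h := (tendsto_nat_add_div_nat_add 2 1).mul (hlim.comp (tendsto_add_atTop_nat 1))
  rw [one_mul] at h
  refine h.congr fun k ↦ ?_
  simp only [derivCoeff, Function.comp_apply, div_mul_div_comm]
  push_cast
  ring_nf

lemma summable_mul_pow (ha : ∀ k, 0 < a k)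
    (hlim : Tendsto (fun k ↦ a (k + 1) / a k) atTop (nhds 1)) {x : ℝ} (hx : |x| < 1) :
    Summable fun k ↦ a k * x ^ k := by
  rcases eq_or_ne x 0 with rfl | h0
  · exact summable_of_ne_finset_zero (s := {0}) fun k hk ↦ by
      simp at hk
      simp [hk]
  refine summable_of_ratio_test_tendsto_lt_one hx
    (Eventually.of_forall fun k ↦ mul_ne_zero (ha k).ne' (pow_ne_zero _ h0)) ?_
  have h := hlim.mul_const |x|
  rw [one_mul] at h
  refine h.congr fun k ↦ ?_
  have h1 := (ha k).ne'
  have h2 := abs_ne_zero.2 h0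
  simp only [norm_mul, norm_pow, Real.norm_eq_abs, abs_of_pos (ha _)]
  field_simp
  ring

lemma hasDerivAt_tsum_mul_pow (ha : ∀ k, 0 < a k)
    (hlim : Tendsto (fun k ↦ a (k + 1) / a k) atTop (nhds 1)) {x : ℝ} (hx : |x| < 1) :
    HasDerivAt (fun x ↦ ∑' k, a k * x ^ k) (∑' k, derivCoeff a k * x ^ k) x := by
  obtain ⟨r, hxr, hr⟩ := exists_between hx
  have hr0 : 0 < r := (abs_nonneg x).trans_lt hxr
  have hr1 : |r| < 1 := by rwa [abs_of_pos hr0]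
  have hshift (y : ℝ) (k : ℕ) :
      a (k + 1) * (((k + 1 : ℕ) : ℝ) * y ^ (k + 1 - 1)) = derivCoeff a k * y ^ k := by
    simp only [derivCoeff, Nat.add_sub_cancel]
    push_cast
    ring
  have hs {y : ℝ} (hy : |y| < 1) : Summable fun k : ℕ ↦ a k * (k * y ^ (k - 1)) := by
    rw [← summable_nat_add_iff 1]
    simpa only [hshift] using
      summable_mul_pow (derivCoeff_pos ha) (tendsto_derivCoeff_div hlim) hy
  have h := hasDerivAt_tsum_of_isPreconnected (g := fun k y ↦ a k * y ^ k)
    (g' := fun k y ↦ a k * (k * y ^ (k - 1))) (t := Set.Ioo (-r) r) (y₀ := 0) (hs hr1) isOpen_Ioo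
    isPreconnected_Ioo (fun k y _ ↦ (hasDerivAt_pow k y).const_mul _) (fun k y hy ↦ ?_)
    ⟨by linarith, hr0⟩ (summable_mul_pow ha hlim (by simp)) (abs_lt.1 hxr)
  · convert! h using 1
    rw [(hs hx).tsum_eq_zero_add]
    simp [derivCoeff]
    congr 1 with k
    ring
  · simp only [norm_mul, norm_pow, Real.norm_eq_abs, abs_of_pos (ha _), Nat.abs_cast]
    have := (ha k).le
    gcongr
    exact (abs_lt.2 hy).le

end PowerSeries

section GreenSeries

lemma poch_succ (x : ℝ) (k : ℕ) : poch x (k + 1) = poch x k * (x + k) :=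
  Finset.prod_range_succ _ _

lemma poch_pos {x : ℝ} (hx : 0 < x) (k : ℕ) : 0 < poch x k :=
  Finset.prod_pos fun _ _ ↦ by positivity

/-- The ratio `(n)_k / (n/2+1)_k` of Pochhammer symbols. -/
noncomputable def pochRatio (n k : ℕ) : ℝ := poch n k / poch ((n : ℝ) / 2 + 1) k

/-- The power series without constant term whose derivative has coefficients `pochRatio n`. -/
noncomputable def greenSeries (n : ℕ) (x : ℝ) : ℝ :=
  x * ∑' k, pochRatio n k / (k + 1) * x ^ k

variable {n : ℕ}

lemma pochRatio_pos (hn : 0 < n) (k : ℕ) : 0 < pochRatio n k :=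
  div_pos (poch_pos (by positivity) k) (poch_pos (by positivity) k)

lemma pochRatio_zero : pochRatio n 0 = 1 := by simp [pochRatio, poch]

lemma pochRatio_succ (k : ℕ) : pochRatio n (k + 1) = pochRatio n k * ((k + n) / (k + (n / 2 + 1))) := by
  rw [pochRatio, pochRatio, poch_succ, poch_succ, mul_div_mul_comm]
  ring_nf

lemma tendsto_pochRatio_div (hn : 0 < n) :
    Tendsto (fun k ↦ pochRatio n (k + 1) / pochRatio n k) atTop (nhds 1) := by
  refine (tendsto_nat_add_div_nat_add n (n / 2 + 1)).congr fun k ↦ ?_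
  rw [pochRatio_succ, mul_div_cancel_left₀ _ (pochRatio_pos hn k).ne']

lemma pochRatio_div_pos (hn : 0 < n) (k : ℕ) : 0 < pochRatio n k / (k + 1) :=
  div_pos (pochRatio_pos hn k) (by positivity)

lemma tendsto_pochRatio_div_div (hn : 0 < n) :
    Tendsto (fun k : ℕ ↦ pochRatio n (k + 1) / ((k + 1 : ℕ) + 1) / (pochRatio n k / (k + 1)))
      atTop (nhds 1) := by
  have h := (tendsto_pochRatio_div hn).mul (tendsto_nat_add_div_nat_add 1 2)
  rw [one_mul] at h
  refine h.congr fun k ↦ ?_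
  have := (pochRatio_pos hn k).ne'
  push_cast
  field_simp
  ring

lemma summable_pochRatio_div_mul_pow (hn : 0 < n) {x : ℝ} (hx : |x| < 1) :
    Summable fun k : ℕ ↦ pochRatio n k / (k + 1) * x ^ k :=
  summable_mul_pow (pochRatio_div_pos hn) (tendsto_pochRatio_div_div hn) hx

lemma greenSeries_nonneg (hn : 0 < n) {x : ℝ} (hx : 0 ≤ x) : 0 ≤ greenSeries n x :=
  mul_nonneg hx (tsum_nonneg fun k ↦ mul_nonneg (pochRatio_div_pos hn k).le (by positivity))

lemma greenSeries_zero : greenSeries n 0 = 0 := zero_mul _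

lemma hasDerivAt_greenSeries (hn : 0 < n) {x : ℝ} (hx : |x| < 1) :
    HasDerivAt (greenSeries n) (∑' k, pochRatio n k * x ^ k) x := by
  have ha := pochRatio_div_pos hn
  have hlim := tendsto_pochRatio_div_div hn
  convert! (hasDerivAt_id x).mul (hasDerivAt_tsum_mul_pow ha hlim hx) using 1
  have hs := summable_mul_pow ha hlim hx
  have hs' := summable_mul_pow (derivCoeff_pos ha) (tendsto_derivCoeff_div hlim) hx
  have hp := summable_mul_pow (pochRatio_pos hn) (tendsto_pochRatio_div hn) hx
  rw [hp.tsum_eq_zero_add, hs.tsum_eq_zero_add, ← tsum_mul_left, one_mul, add_assoc, id,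
    ← Summable.tsum_add ((summable_nat_add_iff 1).2 hs) (hs'.mul_left x)]
  congr 1
  · simp
  · congr 1 with k
    simp only [derivCoeff]
    push_cast
    field_simp
    ring

lemma tsum_pochRatio_ode (hn : 0 < n) {x : ℝ} (hx : |x| < 1) :
    x * (1 - x) * ∑' k, derivCoeff (pochRatio n) k * x ^ k +
      n / 2 * (1 - 2 * x) * ∑' k, pochRatio n k * x ^ k = n / 2 := by
  have ha := pochRatio_pos hn
  have hlim := tendsto_pochRatio_div hn
  have hs' := summable_mul_pow (derivCoeff_pos ha) (tendsto_derivCoeff_div hlim) hx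
  have hs := summable_mul_pow ha hlim hx
  have h1 := hs'.mul_left x
  have h2 := (summable_nat_add_iff 1).2 hs
  have key : x * ∑' k, derivCoeff (pochRatio n) k * x ^ k +
      n / 2 * ∑' k, pochRatio n (k + 1) * x ^ (k + 1) =
      n * x * ∑' k, pochRatio n k * x ^ k +
        x * (x * ∑' k, derivCoeff (pochRatio n) k * x ^ k) := by
    have hshift (k : ℕ) : ((k + 1 : ℕ) : ℝ) * (pochRatio n (k + 1) * x ^ (k + 1)) =
        x * (derivCoeff (pochRatio n) k * x ^ k) := by
      simp only [derivCoeff]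
      push_cast
      ring
    have hsk : Summable fun k : ℕ ↦ (k : ℝ) * (pochRatio n k * x ^ k) := by
      rw [← summable_nat_add_iff 1]
      simpa only [hshift] using h1
    have h3 : x * ∑' k, derivCoeff (pochRatio n) k * x ^ k =
        ∑' k : ℕ, (k : ℝ) * (pochRatio n k * x ^ k) := by
      rw [hsk.tsum_eq_zero_add]
      simp only [hshift]
      simp [tsum_mul_left]
    nth_rw 2 [h3]
    rw [← tsum_mul_left, ← tsum_mul_left, ← tsum_mul_left, ← tsum_mul_left,
      ← Summable.tsum_add h1 (h2.mul_left _), ← Summable.tsum_add (hs.mul_left _) (hsk.mul_left _)]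
    congr 1 with k
    have h4 : (k : ℝ) + (n / 2 + 1) ≠ 0 := by positivity
    simp only [derivCoeff, pochRatio_succ]
    field_simp
    ring
  rw [hs.tsum_eq_zero_add] at key ⊢
  simp only [pochRatio_zero, pow_zero, mul_one] at key ⊢
  linear_combination key

end GreenSeries

section BetaFunction

lemma incBeta_one_eq_beta {α β : ℝ} (hα : 0 < α) (hβ : 0 < β) :
    incBeta 1 α β = ProbabilityTheory.beta α β := by
  have h : Complex.betaIntegral α β = ((incBeta 1 α β : ℝ) : ℂ) := by
    rw [Complex.betaIntegral, incBeta, ← intervalIntegral.integral_ofReal]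
    refine intervalIntegral.integral_congr fun x hx ↦ ?_
    rw [Set.uIcc_of_le zero_le_one] at hx
    push_cast
    rw [Complex.ofReal_cpow hx.1, Complex.ofReal_cpow (sub_nonneg.2 hx.2)]
    push_cast
    rfl
  rw [ProbabilityTheory.beta_eq_betaIntegralReal _ _ hα hβ, h, Complex.ofReal_re]

lemma beta_add_one {α β : ℝ} (hα : 0 < α) (hβ : 0 < β) :
    ProbabilityTheory.beta α (β + 1) = β / (α + β) * ProbabilityTheory.beta α β := by
  have h := (Gamma_pos_of_pos (add_pos hα hβ)).ne'
  have h' := (add_pos hα hβ).ne'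
  rw [ProbabilityTheory.beta, ProbabilityTheory.beta, ← add_assoc, Gamma_add_one hβ.ne',
    Gamma_add_one h']
  field_simp

variable {n : ℕ}

lemma pochRatio_mul_beta_div (hn : 0 < n) (k : ℕ) :
    pochRatio n k * (ProbabilityTheory.beta (n / 2) (n / 2 + k + 1) /
      ProbabilityTheory.beta (n / 2) (n / 2)) = (n / 2 : ℝ) / (n + k) := by
  have h2 : (0 : ℝ) < n / 2 := by positivity
  have hb := (ProbabilityTheory.beta_pos h2 h2).ne'
  induction k with
  | zero =>
    rw [pochRatio_zero, Nat.cast_zero, add_zero, add_zero, beta_add_one h2 h2]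
    field_simp
    norm_num
  | succ k ih =>
    have h3 : (k : ℝ) + (n / 2 + 1) ≠ 0 := by positivity
    have h4 : (n : ℝ) / 2 + (n / 2 + k + 1) ≠ 0 := by positivity
    have h5 : (n : ℝ) + k ≠ 0 := by positivity
    have h6 : (n : ℝ) + (k + 1) ≠ 0 := by positivity
    rw [Nat.cast_add_one, ← add_assoc (n / 2 : ℝ), beta_add_one h2 (by positivity), pochRatio_succ,
      show pochRatio n k * ((k + n) / (k + (n / 2 + 1))) * ((n / 2 + k + 1) /
        (n / 2 + (n / 2 + k + 1)) * ProbabilityTheory.beta (n / 2) (n / 2 + k + 1) /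
          ProbabilityTheory.beta (n / 2) (n / 2)) =
        (k + n) / (k + (n / 2 + 1)) * ((n / 2 + k + 1) / (n / 2 + (n / 2 + k + 1))) *
          (pochRatio n k * (ProbabilityTheory.beta (n / 2) (n / 2 + k + 1) /
          ProbabilityTheory.beta (n / 2) (n / 2))) by ring, ih]
    field_simp
    ring

/-- The constant term of the series of the Green function, up to normalization. -/
noncomputable def greenShift (n : ℕ) : ℝ :=
  ∑' k : ℕ, pochRatio n k / (k + 1) *
    (incBeta 1 ((n : ℝ) / 2) ((n : ℝ) / 2 + k + 1) / incBeta 1 ((n : ℝ) / 2) ((n : ℝ) / 2))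

lemma summable_pochRatio_mul_incBeta (hn : 0 < n) :
    Summable fun k : ℕ ↦ pochRatio n k / (k + 1) *
      (incBeta 1 ((n : ℝ) / 2) ((n : ℝ) / 2 + k + 1) / incBeta 1 ((n : ℝ) / 2) ((n : ℝ) / 2)) := by
  have h2 : (0 : ℝ) < n / 2 := by positivity
  have hs := ((summable_nat_add_iff 1).2
    (Real.summable_one_div_nat_pow.2 one_lt_two)).mul_left ((n : ℝ) / 2)
  have hterm (k : ℕ) : pochRatio n k / (k + 1) *
      (incBeta 1 ((n : ℝ) / 2) ((n : ℝ) / 2 + k + 1) / incBeta 1 ((n : ℝ) / 2) ((n : ℝ) / 2)) =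
      (n / 2 : ℝ) / (n + k) / (k + 1) := by
    rw [incBeta_one_eq_beta h2 (by positivity), incBeta_one_eq_beta h2 h2,
      ← pochRatio_mul_beta_div hn k]
    ring
  refine Summable.of_nonneg_of_le (fun k ↦ by rw [hterm]; positivity) (fun k ↦ ?_) hs
  have hn1 : (1 : ℝ) ≤ n := by exact_mod_cast hn
  rw [hterm, div_div, mul_one_div]
  push_cast
  gcongr
  nlinarith [(k.cast_nonneg : (0 : ℝ) ≤ k)]

lemma incBeta_sin_sq (hn : 2 ≤ n) {a : ℝ} (ha : a ∈ Set.Ioo 0 π) (j : ℕ) :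
    incBeta (sin (a / 2) ^ 2) ((n : ℝ) / 2 + j) ((n : ℝ) / 2) =
      (1 / 2) ^ (n - 1) * ∫ r in (0 : ℝ)..a, sin r ^ (n - 1) * (sin (r / 2) ^ 2) ^ j := by
  have hn2 : (0 : ℝ) ≤ n / 2 - 1 := by
    have : (2 : ℝ) ≤ n := by exact_mod_cast hn
    linarith
  have hd (r : ℝ) : HasDerivAt (fun r ↦ sin (r / 2) ^ 2) (sin (r / 2) * cos (r / 2)) r := by
    convert! ((hasDerivAt_sin (r / 2)).comp r ((hasDerivAt_id r).div_const 2)).pow 2 using 1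
    simp
    ring
  have hcv := intervalIntegral.integral_comp_mul_deriv'' (a := 0) (b := a)
    (f := fun r ↦ sin (r / 2) ^ 2) (f' := fun r ↦ sin (r / 2) * cos (r / 2))
    (g := fun t ↦ t ^ ((n : ℝ) / 2 + j - 1) * (1 - t) ^ ((n : ℝ) / 2 - 1)) (by fun_prop)
    (fun r _ ↦ (hd r).hasDerivWithinAt) (by fun_prop) (by
      have h1 : (0 : ℝ) ≤ n / 2 + j - 1 := by linarith [(j.cast_nonneg : (0 : ℝ) ≤ j)]
      exact ((continuous_rpow_const h1).mul
        ((continuous_rpow_const hn2).comp (by fun_prop))).continuousOn)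
  simp only [zero_div, sin_zero, ne_eq, OfNat.ofNat_ne_zero, not_false_eq_true, zero_pow] at hcv
  rw [incBeta, ← hcv, ← intervalIntegral.integral_const_mul]
  refine intervalIntegral.integral_congr fun r hr ↦ ?_
  rw [Set.uIcc_of_le ha.1.le] at hr
  have hs : 0 ≤ sin (r / 2) := sin_nonneg_of_nonneg_of_le_pi (by linarith [hr.1])
    (by linarith [hr.1, hr.2, ha.2])
  have hc : 0 ≤ cos (r / 2) := cos_nonneg_of_mem_Icc ⟨by linarith [hr.1, pi_pos],
    by linarith [hr.2, ha.2]⟩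
  obtain ⟨m, rfl⟩ : ∃ m, n = m + 2 := ⟨n - 2, by omega⟩
  have hm : ((m + 2 : ℕ) : ℝ) / 2 - 1 = m / 2 := by push_cast; ring
  have hpow {y : ℝ} (hy : 0 ≤ y) : (y ^ 2) ^ ((m : ℝ) / 2) = y ^ m := by
    rw [← rpow_natCast_mul hy, Nat.cast_ofNat, mul_div_cancel₀ _ two_ne_zero, rpow_natCast]
  have hcos : 1 - sin (r / 2) ^ 2 = cos (r / 2) ^ 2 := by
    linear_combination -sin_sq_add_cos_sq (r / 2)
  have hsin : sin r = 2 * sin (r / 2) * cos (r / 2) := by rw [← sin_two_mul]; ring_nf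
  simp only [Function.comp_apply]
  rw [add_sub_right_comm, rpow_add_of_nonneg (by positivity) hn2 (by positivity), hm, hcos,
    hpow hs, hpow hc, rpow_natCast, hsin, show m + 2 - 1 = m + 1 by omega, mul_pow, mul_pow]
  have : (1 / 2 : ℝ) ^ (m + 1) * 2 ^ (m + 1) = 1 := by rw [← mul_pow]; norm_num
  linear_combination (-(sin (r / 2)) ^ (m + 1) * cos (r / 2) ^ (m + 1) *
    (sin (r / 2) ^ 2) ^ j) * this

end BetaFunction

section Main

variable {n : ℕ}

lemma measurable_greenSeries : Measurable (greenSeries n) :=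
  measurable_id.mul (Measurable.tsum fun _ ↦ by fun_prop)

lemma integral_sin_pow_pos_of_mem_Ioo {a : ℝ} (ha : a ∈ Set.Ioo 0 π) (m : ℕ) :
    0 < ∫ r in (0 : ℝ)..a, sin r ^ m :=
  intervalIntegral.intervalIntegral_pos_of_pos_on (Continuous.intervalIntegrable (by fun_prop) _ _)
    (fun _ hr ↦ pow_pos (sin_pos_of_pos_of_lt_pi hr.1 (hr.2.trans ha.2)) m) ha.1

lemma abs_sin_half_sq_lt_one {r : ℝ} (hr : r ∈ Set.Ioo (-π) π) : |sin (r / 2) ^ 2| < 1 := by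
  have := cos_pos_of_mem_Ioo (x := r / 2) ⟨by linarith [hr.1], by linarith [hr.2]⟩
  rw [abs_of_nonneg (sq_nonneg _)]
  nlinarith [sin_sq_add_cos_sq (r / 2)]

lemma intervalIntegrable_sin_pow_mul_greenSeries (hn : 0 < n) {a : ℝ} (ha : a ∈ Set.Ioo 0 π)
    (m : ℕ) :
    IntervalIntegrable (fun r ↦ sin r ^ m * greenSeries n (sin (r / 2) ^ 2)) volume 0 a := by
  refine ContinuousOn.intervalIntegrable fun r hr ↦ ContinuousAt.continuousWithinAt ?_
  rw [Set.uIcc_of_le ha.1.le] at hr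
  have h := abs_sin_half_sq_lt_one ⟨by linarith [hr.1, pi_pos], hr.2.trans_lt ha.2⟩
  exact ContinuousAt.mul (by fun_prop) (ContinuousAt.comp (f := fun r ↦ sin (r / 2) ^ 2)
    (hasDerivAt_greenSeries hn h).continuousAt (by fun_prop))

lemma integral_sin_pow_mul_greenSeries (hn : 0 < n) {a : ℝ} (ha : a ∈ Set.Ioo 0 π) :
    ∫ r in (0 : ℝ)..a, sin r ^ (n - 1) * greenSeries n (sin (r / 2) ^ 2) =
      ∑' k : ℕ, pochRatio n k / (k + 1) *
        ∫ r in (0 : ℝ)..a, sin r ^ (n - 1) * (sin (r / 2) ^ 2) ^ (k + 1) := by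
  have hx {r : ℝ} (hr : r ∈ Set.uIoc 0 a) : |sin (r / 2) ^ 2| ≤ sin (a / 2) ^ 2 := by
    rw [Set.uIoc_of_le ha.1.le] at hr
    rw [abs_of_nonneg (sq_nonneg _)]
    have hs : 0 ≤ sin (r / 2) := sin_nonneg_of_nonneg_of_le_pi (by linarith [hr.1])
      (by linarith [hr.1, hr.2, ha.2])
    gcongr
    exact sin_le_sin_of_le_of_le_pi_div_two (by linarith [hr.1, pi_pos]) (by linarith [ha.2])
      (by linarith [hr.2])
  have h1 := abs_sin_half_sq_lt_one ⟨by linarith [ha.1, pi_pos], ha.2⟩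
  have hs {x : ℝ} (hx : |x| < 1) : Summable fun k : ℕ ↦ pochRatio n k / (k + 1) * x ^ (k + 1) := by
    refine ((summable_pochRatio_div_mul_pow hn hx).mul_left x).congr fun k ↦ ?_
    ring
  have h := intervalIntegral.hasSum_integral_of_dominated_convergence (μ := volume) (a := 0) (b := a)
    (F := fun (k : ℕ) r ↦ pochRatio n k / (k + 1) * (sin r ^ (n - 1) * (sin (r / 2) ^ 2) ^ (k + 1)))
    (f := fun r ↦ sin r ^ (n - 1) * greenSeries n (sin (r / 2) ^ 2))
    (fun (k : ℕ) _ ↦ pochRatio n k / (k + 1) * (sin (a / 2) ^ 2) ^ (k + 1))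
    (fun k ↦ Continuous.aestronglyMeasurable (by fun_prop))
    (fun k ↦ ae_of_all _ fun r hr ↦ ?_) (ae_of_all _ fun _ _ ↦ hs h1)
    intervalIntegrable_const (ae_of_all _ fun r hr ↦ ?_)
  · rw [← h.tsum_eq]
    simp_rw [intervalIntegral.integral_const_mul]
  · have := (pochRatio_div_pos hn k).le
    rw [norm_mul, norm_mul, norm_pow, norm_pow, Real.norm_of_nonneg this]
    gcongr
    calc _ ≤ 1 * (sin (a / 2) ^ 2) ^ (k + 1) := by
          gcongr
          · exact pow_le_one₀ (norm_nonneg _) (abs_sin_le_one r)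
          · exact hx hr
      _ = _ := one_mul _
  · have h2 := (hs ((hx hr).trans_lt (lt_of_abs_lt h1))).hasSum.mul_left (sin r ^ (n - 1))
    convert! h2 using 1
    · ext k; ring
    · rw [greenSeries, ← tsum_mul_left]
      congr 2 with k
      ring

lemma Kfun_eq (hn : 2 ≤ n) {a : ℝ} (ha : a ∈ Set.Ioo 0 π) :
    Kfun n a = 2 / (n * sphereVol n) *
      ((∫ r in (0 : ℝ)..a, sin r ^ (n - 1) * greenSeries n (sin (r / 2) ^ 2)) /
        ∫ r in (0 : ℝ)..a, sin r ^ (n - 1)) := by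
  rw [Kfun, integral_sin_pow_mul_greenSeries (by omega) ha, ← tsum_div_const]
  congr 2 with k
  have h1 := incBeta_sin_sq hn ha (k + 1)
  have h0 := incBeta_sin_sq hn ha 0
  have hp : ((1 / 2 : ℝ) ^ (n - 1)) ≠ 0 := by positivity
  push_cast at h1 h0
  simp only [add_zero, pow_zero, mul_one] at h0
  rw [add_assoc ((n : ℝ) / 2), h1, h0, mul_div_mul_left _ _ hp, pochRatio, ← div_div]
  ring

lemma green_eq (hn : 0 < n) {t : ℝ} (ht : |1 - t ^ 2 / 4| < 1) :
    green n t = 2 / (n * sphereVol n) * (greenSeries n (1 - t ^ 2 / 4) - greenShift n) := by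
  rw [green, greenSeries, greenShift]
  congr 1
  rw [← tsum_mul_left, ← Summable.tsum_sub
    ((summable_pochRatio_div_mul_pow hn ht).mul_left _) (summable_pochRatio_mul_incBeta hn)]
  congr 1 with k
  rw [pochRatio, mul_comm ((k : ℝ) + 1), ← div_div]
  ring

end Main

section Cap

variable {n : ℕ}

lemma abs_half_one_add_lt {u : ℝ} (hu : u ∈ Set.Ioo (-3 : ℝ) 1) : |(1 + u) / 2| < 1 :=
  abs_lt.2 ⟨by linarith [hu.1], by linarith [hu.2]⟩

lemma HasDerivAt.comp_half_one_add {f : ℝ → ℝ} {f' u : ℝ} (h : HasDerivAt f f' ((1 + u) / 2)) :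
    HasDerivAt (fun u ↦ f ((1 + u) / 2)) (f' * (1 / 2)) u :=
  h.comp u (((hasDerivAt_id u).const_add 1).div_const 2)

lemma integral_cap_greenSeries (hn : 2 ≤ n)
    {p₀ p : Metric.sphere (0 : EuclideanSpace ℝ (Fin (n + 1))) 1} {a : ℝ} (ha : a ∈ Set.Ioo 0 π)
    (hp : a ≤ arccos ⟪(p₀ : EuclideanSpace ℝ (Fin (n + 1))),
      (p : EuclideanSpace ℝ (Fin (n + 1)))⟫) :
    Integrable (fun q : Metric.sphere (0 : EuclideanSpace ℝ (Fin (n + 1))) 1 ↦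
      greenSeries n ((1 + ⟪(p : EuclideanSpace ℝ (Fin (n + 1))), (q : _)⟫) / 2))
      (capMeasure (p₀ : EuclideanSpace ℝ (Fin (n + 1))) a) ∧
    ∫ q, greenSeries n ((1 + ⟪(p : EuclideanSpace ℝ (Fin (n + 1))), (q : _)⟫) / 2)
      ∂(capMeasure (p₀ : EuclideanSpace ℝ (Fin (n + 1))) a) =
    sphereVol (n - 1) * ∫ r in (0 : ℝ)..a, sin r ^ (n - 1) *
      (greenSeries n ((1 + ⟪(p₀ : EuclideanSpace ℝ (Fin (n + 1))), (p : _)⟫) / 2) +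
        greenSeries n (sin (r / 2) ^ 2)) := by
  have hn0 : 0 < n := by omega
  have hb := pochRatio_pos hn0
  have hb' := tendsto_pochRatio_div hn0
  have h := integral_capMeasure_comp_inner (p₀ := (p₀ : EuclideanSpace ℝ (Fin (n + 1))))
    (p := (p : EuclideanSpace ℝ (Fin (n + 1)))) (n := n) (C := n / 2)
    (G := fun u ↦ greenSeries n ((1 + u) / 2))
    (G' := fun u ↦ (∑' k, pochRatio n k * ((1 + u) / 2) ^ k) * (1 / 2))
    (G'' := fun u ↦ (∑' k, derivCoeff (pochRatio n) k * ((1 + u) / 2) ^ k) * (1 / 2) * (1 / 2)) ha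
    (fun u hu ↦ (hasDerivAt_greenSeries hn0 (abs_half_one_add_lt hu)).comp_half_one_add)
    (fun u hu ↦ (hasDerivAt_tsum_mul_pow hb hb'
      (abs_half_one_add_lt hu)).comp_half_one_add.mul_const _)
    (fun u hu ↦ (((hasDerivAt_tsum_mul_pow (derivCoeff_pos hb) (tendsto_derivCoeff_div hb')
      (abs_half_one_add_lt hu)).comp_half_one_add.mul_const _).mul_const
      _).continuousAt.continuousWithinAt)
    (fun u hu ↦ greenSeries_nonneg hn0 (by linarith [hu.1])) hn
    (fun u hu ↦ by
      linear_combination tsum_pochRatio_ode hn0 (abs_half_one_add_lt hu))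
    (by simp) (by simp) (by simp) hp
  refine ⟨h.1, h.2.trans ?_⟩
  have hf : Measurable fun u : ℝ ↦
      greenSeries n ((1 + ⟪(p₀ : EuclideanSpace ℝ (Fin (n + 1))), (p : _)⟫) / 2) +
        greenSeries n ((1 - u) / 2) :=
    (measurable_greenSeries.comp (by fun_prop)).const_add _
  have hcap := setIntegral_cap_inner (by omega) p₀ ha hf
  have hhalf (r : ℝ) : (1 - cos r) / 2 = sin (r / 2) ^ 2 := by
    rw [sin_sq_eq_half_sub]; ring_nf
  simp only [hhalf] at hcap
  rw [← hcap, sphereMeasure, capMeasure]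
  simp [inner_neg_left, greenSeries_zero, sub_eq_add_neg]

lemma green_norm_sub (hn : 0 < n) {p q : Metric.sphere (0 : EuclideanSpace ℝ (Fin (n + 1))) 1}
    (hpq : p ≠ q) :
    green n ‖(p : EuclideanSpace ℝ (Fin (n + 1))) - (q : EuclideanSpace ℝ (Fin (n + 1)))‖ =
      2 / (n * sphereVol n) *
        (greenSeries n ((1 + ⟪(p : EuclideanSpace ℝ (Fin (n + 1))), (q : _)⟫) / 2) -
          greenShift n) := by
  have hp : ‖(p : EuclideanSpace ℝ (Fin (n + 1)))‖ = 1 := by simp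
  have hq : ‖(q : EuclideanSpace ℝ (Fin (n + 1)))‖ = 1 := by simp
  have hu := inner_mem_Icc_of_norm_eq_one hp q
  have hu1 := hu.2.lt_of_ne fun h ↦
    hpq (Subtype.ext ((inner_eq_one_iff_of_norm_eq_one hp hq).1 h))
  have ht : 1 - ‖(p : EuclideanSpace ℝ (Fin (n + 1))) - (q : _)‖ ^ 2 / 4 =
      (1 + ⟪(p : EuclideanSpace ℝ (Fin (n + 1))), (q : _)⟫) / 2 := by
    rw [norm_sub_sq_real, hp, hq]
    ring
  rw [green_eq hn (by rw [ht]; exact abs_half_one_add_lt ⟨by linarith [hu.1], hu1⟩), ht]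

end Cap

theorem stmt_13 (n : ℕ) (hn : 2 ≤ n)
    (p₀ p : Metric.sphere (0 : EuclideanSpace ℝ (Fin (n + 1))) 1)
    (a : ℝ) (ha : a ∈ Set.Ioo 0 π)
    (hp : a ≤ Real.arccos ⟪(p₀ : EuclideanSpace ℝ (Fin (n + 1))), (p : EuclideanSpace ℝ (Fin (n + 1)))⟫) :
    1 / ballVol n a *
        ∫ q in {q : Metric.sphere (0 : EuclideanSpace ℝ (Fin (n + 1))) 1 |
            Real.arccos ⟪(p₀ : EuclideanSpace ℝ (Fin (n + 1))), (q : EuclideanSpace ℝ (Fin (n + 1)))⟫ < a},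
          green n ‖(p : EuclideanSpace ℝ (Fin (n + 1))) - (q : EuclideanSpace ℝ (Fin (n + 1)))‖
            ∂(sphereMeasure n) =
      green n ‖(p : EuclideanSpace ℝ (Fin (n + 1))) - (p₀ : EuclideanSpace ℝ (Fin (n + 1)))‖
        + Kfun n a := by
  have hn0 : 0 < n := by omega
  have hne : p ≠ p₀ := by
    rintro rfl
    rw [real_inner_self_eq_norm_sq, norm_eq_of_mem_sphere, one_pow, arccos_one] at hp
    exact ha.1.not_ge hp
  have hvol : 0 < sphereVol (n - 1) := by
    have : 0 < Gamma (((n - 1 : ℕ) + 1) / 2) := Gamma_pos_of_pos (by positivity)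
    rw [sphereVol]
    positivity
  have hI := integral_sin_pow_pos_of_mem_Ioo ha (n - 1)
  obtain ⟨hint, hval⟩ := integral_cap_greenSeries hn ha hp
  have hmeas : (capMeasure (p₀ : EuclideanSpace ℝ (Fin (n + 1))) a).real Set.univ =
      ballVol n a := by
    have h := setIntegral_cap_inner (by omega) p₀ ha (measurable_const (a := (1 : ℝ)))
    rw [setIntegral_const, smul_eq_mul, mul_one] at h
    simp only [mul_one] at h
    rw [ballVol, ← h, capMeasure, measureReal_restrict_apply_univ, sphereMeasure]
  have hsub := intervalIntegrable_sin_pow_mul_greenSeries hn0 ha (n - 1)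
  rw [setIntegral_congr_fun (measurableSet_arccos_inner_lt _ _) fun q (hq : arccos _ < a) ↦
    green_norm_sub hn0 (p := p) (q := q) (by rintro rfl; exact hq.not_ge hp),
    green_norm_sub hn0 hne, Kfun_eq hn ha, integral_const_mul]
  change _ * (_ * ∫ q, _ ∂(capMeasure (p₀ : EuclideanSpace ℝ (Fin (n + 1))) a)) = _
  rw [integral_sub hint (integrable_const _), hval, integral_const, hmeas, ballVol, smul_eq_mul,
    real_inner_comm]
  simp_rw [mul_add]
  rw [intervalIntegral.integral_add (Continuous.intervalIntegrable (by fun_prop) _ _) hsub,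
    intervalIntegral.integral_mul_const]
  field_simp
  ring
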